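/- arXiv:math/0010054 — 2 statements merged into one kernel-verified Lean document; each statement's English description precedes it below -/
import Mathlib

section
/- The function φ is differentiable on U, and for every Ω ∈ U and every Ω̇ ∈ Λ³W* its derivative satisfies Dφ_Ω(Ω̇)·ε = −Ω̂ ∧ Ω̇. -/
open scoped TensorProduct

noncomputable section

/-- The wedge product of alternating forms valued in a commutative algebra,
obtained from `AlternatingMap.domCoprod` (the sum over shuffles, so that the
wedge of covectors is given by a determinant). -/
def wedge {R A M : Type*} [CommRing R] [CommRing A] [Algebra R A]
    [AddCommGroup M] [Module R M] {m n : ℕ}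
    (α : AlternatingMap R M A (Fin m)) (β : AlternatingMap R M A (Fin n)) :
    AlternatingMap R M A (Fin (m + n)) :=
  (LinearMap.mul' R A).compAlternatingMap
    ((α.domCoprod β).domDomCongr finSumFinEquiv)

/-- A linear map regarded as an alternating 1-form. -/
def oneForm {R A M : Type*} [CommRing R] [CommRing A] [Algebra R A]
    [AddCommGroup M] [Module R M] (ξ : M →ₗ[R] A) : AlternatingMap R M A (Fin 1) :=
  AlternatingMap.ofSubsingleton R M A 0 ξ

/-- A 3-form is decomposable if it is the wedge of three covectors. -/
def IsDecomposable {R A M : Type*} [CommRing R] [CommRing A] [Algebra R A]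
    [AddCommGroup M] [Module R M] (α : AlternatingMap R M A (Fin 3)) : Prop :=
  ∃ ξ₁ ξ₂ ξ₃ : M →ₗ[R] A,
    α = wedge (oneForm ξ₁) (wedge (oneForm ξ₂) (oneForm ξ₃))
/-- The complexification of a real alternating form on `W`, i.e. the
`ℂ`-valued form corresponding to the complex-multilinear extension to `W ⊗ ℂ`
(a complex `n`-form on `W ⊗ ℂ` is uniquely determined by its restriction to
`W`, an `ℝ`-multilinear `ℂ`-valued alternating form). -/
def cx {W : Type*} [AddCommGroup W] [Module ℝ W] {n : ℕ}
    (Ω : AlternatingMap ℝ W ℝ (Fin n)) : AlternatingMap ℝ W ℂ (Fin n) :=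
  (Algebra.linearMap ℝ ℂ).compAlternatingMap Ω

/-- The conjugate of a complex alternating form (corresponding to the
conjugation of complex forms induced by the real structure on `W ⊗ ℂ`). -/
def conjForm {W : Type*} [AddCommGroup W] [Module ℝ W] {n : ℕ}
    (α : AlternatingMap ℝ W ℂ (Fin n)) : AlternatingMap ℝ W ℂ (Fin n) :=
  (Complex.conjAe.toLinearMap).compAlternatingMap α

open Equiv in
theorem wedge_reps {m n N : ℕ} (reps : Fin N → Perm (Fin m ⊕ Fin n))
    (IA : Fin N → Fin m → Fin (m + n)) (IB : Fin N → Fin n → Fin (m + n)) (s : Fin N → ℤˣ)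
    (hN : N * (m.factorial * n.factorial) = (m + n).factorial)
    (hinj : ∀ i j, i ≠ j → ∃ x, ∀ y, reps i (Sum.inl x) ≠ reps j (Sum.inl y))
    (hA : ∀ i x, finSumFinEquiv (reps i (Sum.inl x)) = IA i x)
    (hB : ∀ i x, finSumFinEquiv (reps i (Sum.inr x)) = IB i x)
    (hs : ∀ i, Perm.sign (reps i) = s i)
    {R A M : Type*} [CommRing R] [CommRing A] [Algebra R A]
    [AddCommGroup M] [Module R M]
    (α : AlternatingMap R M A (Fin m)) (β : AlternatingMap R M A (Fin n)) (v : Fin (m + n) → M) :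
    wedge α β v = ∑ i, (s i) • (α (v ∘ IA i) * β (v ∘ IB i)) := by
  classical
  have hbij : Function.Bijective
      (fun i => (Quotient.mk'' (reps i) : Perm.ModSumCongr (Fin m) (Fin n))) := by
    rw [Nat.bijective_iff_injective_and_card]
    constructor
    · intro i j hij
      by_contra hne
      obtain ⟨x, hx⟩ := hinj i j hne
      have h := (QuotientGroup.leftRel_apply.mp (Quotient.exact' hij.symm))
      obtain ⟨⟨sl, sr⟩, h⟩ := h
      replace h := inv_mul_eq_iff_eq_mul.mp h.symm
      apply hx (sl x)
      rw [h]
      simp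
    · have h := Subgroup.card_eq_card_quotient_mul_card_subgroup
        (Equiv.Perm.sumCongrHom (Fin m) (Fin n)).range
      rw [Nat.card_eq_fintype_card (α := (Equiv.Perm.sumCongrHom (Fin m) (Fin n)).range),
        Equiv.Perm.sumCongrHom.card_range, Fintype.card_prod, Nat.card_eq_fintype_card,
        Fintype.card_perm, Fintype.card_perm, Fintype.card_perm, Fintype.card_sum] at h
      simp only [Fintype.card_fin] at h
      rw [← hN] at h
      simp only [Nat.card_eq_fintype_card (α := Fin N), Fintype.card_fin]
      exact Nat.eq_of_mul_eq_mul_right (by positivity) h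
  have h1 : wedge α β v = (LinearMap.mul' R A) (∑ σ : Perm.ModSumCongr (Fin m) (Fin n),
      AlternatingMap.domCoprod.summand α β σ (v ∘ finSumFinEquiv)) := by
    simp only [wedge, LinearMap.compAlternatingMap_apply, AlternatingMap.domDomCongr_apply,
      AlternatingMap.domCoprod_apply, sum_apply]
  rw [h1, map_sum]
  symm
  refine Fintype.sum_bijective _ hbij _ _ ?_
  intro i
  rw [AlternatingMap.domCoprod.summand_mk'']
  have e1 : v ∘ IA i = fun x => v (finSumFinEquiv (reps i (Sum.inl x))) := by
    funext x; simp [hA]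
  have e2 : v ∘ IB i = fun x => v (finSumFinEquiv (reps i (Sum.inr x))) := by
    funext x; simp [hB]
  rw [e1, e2, ← hs]
  rcases Int.units_eq_one_or (Perm.sign (reps i)) with h | h <;> rw [h] <;>
  simp [MultilinearMap.domCoprod_apply, Function.comp_def]

def reps11 : Fin 2 → Equiv.Perm (Fin 1 ⊕ Fin 1) :=
  ![1,
    Equiv.swap (Sum.inl 0) (Sum.inr 0)]

def idxA11 : Fin 2 → Fin 1 → Fin 2 :=
  ![![0], ![1]]

def idxB11 : Fin 2 → Fin 1 → Fin 2 :=
  ![![1], ![0]]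

def sg11 : Fin 2 → ℤˣ := ![1, -1]

theorem wedge11 {R A M : Type*} [CommRing R] [CommRing A] [Algebra R A]
    [AddCommGroup M] [Module R M]
    (α : AlternatingMap R M A (Fin 1)) (β : AlternatingMap R M A (Fin 1)) (v : Fin 2 → M) :
    wedge α β v = ∑ i, (sg11 i) • (α (v ∘ idxA11 i) * β (v ∘ idxB11 i)) := by
  refine wedge_reps reps11 _ _ _ ?_ ?_ ?_ ?_ ?_ α β v
  · decide
  · decide
  · decide +kernel
  · decide +kernel
  · intro i; fin_cases i <;> simp [reps11, sg11]

def reps12 : Fin 3 → Equiv.Perm (Fin 1 ⊕ Fin 2) :=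
  ![1,
    Equiv.swap (Sum.inl 0) (Sum.inr 0),
    Equiv.swap (Sum.inl 0) (Sum.inr 1)]

def idxA12 : Fin 3 → Fin 1 → Fin 3 :=
  ![![0], ![1], ![2]]

def idxB12 : Fin 3 → Fin 2 → Fin 3 :=
  ![![1, 2], ![0, 2], ![1, 0]]

def sg12 : Fin 3 → ℤˣ := ![1, -1, -1]

theorem wedge12 {R A M : Type*} [CommRing R] [CommRing A] [Algebra R A]
    [AddCommGroup M] [Module R M]
    (α : AlternatingMap R M A (Fin 1)) (β : AlternatingMap R M A (Fin 2)) (v : Fin 3 → M) :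
    wedge α β v = ∑ i, (sg12 i) • (α (v ∘ idxA12 i) * β (v ∘ idxB12 i)) := by
  refine wedge_reps reps12 _ _ _ ?_ ?_ ?_ ?_ ?_ α β v
  · decide
  · decide
  · decide +kernel
  · decide +kernel
  · intro i; fin_cases i <;> simp [reps12, sg12]

def reps15 : Fin 6 → Equiv.Perm (Fin 1 ⊕ Fin 5) :=
  ![1,
    Equiv.swap (Sum.inl 0) (Sum.inr 0),
    Equiv.swap (Sum.inl 0) (Sum.inr 1),
    Equiv.swap (Sum.inl 0) (Sum.inr 2),
    Equiv.swap (Sum.inl 0) (Sum.inr 3),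
    Equiv.swap (Sum.inl 0) (Sum.inr 4)]

def idxA15 : Fin 6 → Fin 1 → Fin 6 :=
  ![![0], ![1], ![2], ![3], ![4], ![5]]

def idxB15 : Fin 6 → Fin 5 → Fin 6 :=
  ![![1, 2, 3, 4, 5], ![0, 2, 3, 4, 5], ![1, 0, 3, 4, 5], ![1, 2, 0, 4, 5], ![1, 2, 3, 0, 5], ![1, 2, 3, 4, 0]]

def sg15 : Fin 6 → ℤˣ := ![1, -1, -1, -1, -1, -1]

theorem wedge15 {R A M : Type*} [CommRing R] [CommRing A] [Algebra R A]
    [AddCommGroup M] [Module R M]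
    (α : AlternatingMap R M A (Fin 1)) (β : AlternatingMap R M A (Fin 5)) (v : Fin 6 → M) :
    wedge α β v = ∑ i, (sg15 i) • (α (v ∘ idxA15 i) * β (v ∘ idxB15 i)) := by
  refine wedge_reps reps15 _ _ _ ?_ ?_ ?_ ?_ ?_ α β v
  · decide
  · decide
  · decide +kernel
  · decide +kernel
  · intro i; fin_cases i <;> simp [reps15, sg15]

def reps23 : Fin 10 → Equiv.Perm (Fin 2 ⊕ Fin 3) :=
  ![1,
    Equiv.swap (Sum.inl 0) (Sum.inr 0),
    Equiv.swap (Sum.inl 0) (Sum.inr 1),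
    Equiv.swap (Sum.inl 0) (Sum.inr 2),
    Equiv.swap (Sum.inl 1) (Sum.inr 0),
    Equiv.swap (Sum.inl 1) (Sum.inr 1),
    Equiv.swap (Sum.inl 1) (Sum.inr 2),
    Equiv.swap (Sum.inl 0) (Sum.inr 0) * Equiv.swap (Sum.inl 1) (Sum.inr 1),
    Equiv.swap (Sum.inl 0) (Sum.inr 0) * Equiv.swap (Sum.inl 1) (Sum.inr 2),
    Equiv.swap (Sum.inl 0) (Sum.inr 1) * Equiv.swap (Sum.inl 1) (Sum.inr 2)]

def idxA23 : Fin 10 → Fin 2 → Fin 5 :=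
  ![![0, 1], ![2, 1], ![3, 1], ![4, 1], ![0, 2], ![0, 3], ![0, 4], ![2, 3], ![2, 4], ![3, 4]]

def idxB23 : Fin 10 → Fin 3 → Fin 5 :=
  ![![2, 3, 4], ![0, 3, 4], ![2, 0, 4], ![2, 3, 0], ![1, 3, 4], ![2, 1, 4], ![2, 3, 1], ![0, 1, 4], ![0, 3, 1], ![2, 0, 1]]

def sg23 : Fin 10 → ℤˣ := ![1, -1, -1, -1, -1, -1, -1, 1, 1, 1]

theorem wedge23 {R A M : Type*} [CommRing R] [CommRing A] [Algebra R A]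
    [AddCommGroup M] [Module R M]
    (α : AlternatingMap R M A (Fin 2)) (β : AlternatingMap R M A (Fin 3)) (v : Fin 5 → M) :
    wedge α β v = ∑ i, (sg23 i) • (α (v ∘ idxA23 i) * β (v ∘ idxB23 i)) := by
  refine wedge_reps reps23 _ _ _ ?_ ?_ ?_ ?_ ?_ α β v
  · decide
  · decide
  · decide +kernel
  · decide +kernel
  · intro i; fin_cases i <;> simp [reps23, sg23]

def reps33 : Fin 20 → Equiv.Perm (Fin 3 ⊕ Fin 3) :=
  ![1,
    Equiv.swap (Sum.inl 0) (Sum.inr 0),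
    Equiv.swap (Sum.inl 0) (Sum.inr 1),
    Equiv.swap (Sum.inl 0) (Sum.inr 2),
    Equiv.swap (Sum.inl 1) (Sum.inr 0),
    Equiv.swap (Sum.inl 1) (Sum.inr 1),
    Equiv.swap (Sum.inl 1) (Sum.inr 2),
    Equiv.swap (Sum.inl 2) (Sum.inr 0),
    Equiv.swap (Sum.inl 2) (Sum.inr 1),
    Equiv.swap (Sum.inl 2) (Sum.inr 2),
    Equiv.swap (Sum.inl 0) (Sum.inr 0) * Equiv.swap (Sum.inl 1) (Sum.inr 1),
    Equiv.swap (Sum.inl 0) (Sum.inr 0) * Equiv.swap (Sum.inl 1) (Sum.inr 2),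
    Equiv.swap (Sum.inl 0) (Sum.inr 1) * Equiv.swap (Sum.inl 1) (Sum.inr 2),
    Equiv.swap (Sum.inl 0) (Sum.inr 0) * Equiv.swap (Sum.inl 2) (Sum.inr 1),
    Equiv.swap (Sum.inl 0) (Sum.inr 0) * Equiv.swap (Sum.inl 2) (Sum.inr 2),
    Equiv.swap (Sum.inl 0) (Sum.inr 1) * Equiv.swap (Sum.inl 2) (Sum.inr 2),
    Equiv.swap (Sum.inl 1) (Sum.inr 0) * Equiv.swap (Sum.inl 2) (Sum.inr 1),
    Equiv.swap (Sum.inl 1) (Sum.inr 0) * Equiv.swap (Sum.inl 2) (Sum.inr 2),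
    Equiv.swap (Sum.inl 1) (Sum.inr 1) * Equiv.swap (Sum.inl 2) (Sum.inr 2),
    Equiv.swap (Sum.inl 0) (Sum.inr 0) * Equiv.swap (Sum.inl 1) (Sum.inr 1) * Equiv.swap (Sum.inl 2) (Sum.inr 2)]

def idxA33 : Fin 20 → Fin 3 → Fin 6 :=
  ![![0, 1, 2], ![3, 1, 2], ![4, 1, 2], ![5, 1, 2], ![0, 3, 2], ![0, 4, 2], ![0, 5, 2], ![0, 1, 3], ![0, 1, 4], ![0, 1, 5], ![3, 4, 2], ![3, 5, 2], ![4, 5, 2], ![3, 1, 4], ![3, 1, 5], ![4, 1, 5], ![0, 3, 4], ![0, 3, 5], ![0, 4, 5], ![3, 4, 5]]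

def idxB33 : Fin 20 → Fin 3 → Fin 6 :=
  ![![3, 4, 5], ![0, 4, 5], ![3, 0, 5], ![3, 4, 0], ![1, 4, 5], ![3, 1, 5], ![3, 4, 1], ![2, 4, 5], ![3, 2, 5], ![3, 4, 2], ![0, 1, 5], ![0, 4, 1], ![3, 0, 1], ![0, 2, 5], ![0, 4, 2], ![3, 0, 2], ![1, 2, 5], ![1, 4, 2], ![3, 1, 2], ![0, 1, 2]]

def sg33 : Fin 20 → ℤˣ := ![1, -1, -1, -1, -1, -1, -1, -1, -1, -1, 1, 1, 1, 1, 1, 1, 1, 1, 1, -1]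

theorem wedge33 {R A M : Type*} [CommRing R] [CommRing A] [Algebra R A]
    [AddCommGroup M] [Module R M]
    (α : AlternatingMap R M A (Fin 3)) (β : AlternatingMap R M A (Fin 3)) (v : Fin 6 → M) :
    wedge α β v = ∑ i, (sg33 i) • (α (v ∘ idxA33 i) * β (v ∘ idxB33 i)) := by
  refine wedge_reps reps33 _ _ _ ?_ ?_ ?_ ?_ ?_ α β v
  · decide
  · decide
  · decide +kernel
  · decide +kernel
  · intro i; fin_cases i <;> simp [reps33, sg33]

/-- The 3x3 determinant expansion. -/
def det3 {A : Type*} [CommRing A] (p q r : Fin 3 → A) : A :=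
  p 0 * (q 1 * r 2 - q 2 * r 1) - p 1 * (q 0 * r 2 - q 2 * r 0) - p 2 * (q 1 * r 0 - q 0 * r 1)

theorem decomp_apply {R A M : Type*} [CommRing R] [CommRing A] [Algebra R A]
    [AddCommGroup M] [Module R M] (p q r : M →ₗ[R] A) (v : Fin 3 → M) :
    wedge (oneForm p) (wedge (oneForm q) (oneForm r)) v =
      det3 (fun i => p (v i)) (fun i => q (v i)) (fun i => r (v i)) := by
  rw [wedge12]
  simp only [wedge11]
  simp [Fin.sum_univ_succ, sg12, sg11, idxA12, idxB12, idxA11, idxB11, oneForm, det3]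
  ring

/-- the coefficient of `θ ∧ ι_v Ω₁ ∧ Ω₂` in coordinates. -/
def kk {A : Type*} [CommRing A] (w₁ w₂ : Fin 6 → Fin 6 → Fin 6 → A) (i j : Fin 6) : A :=
  ∑ p, sg15 p • ((if idxA15 p 0 = i then 1 else 0) *
    ∑ q, sg23 q • (w₁ j (idxB15 p (idxA23 q 0)) (idxB15 p (idxA23 q 1)) *
      w₂ (idxB15 p (idxB23 q 0)) (idxB15 p (idxB23 q 1)) (idxB15 p (idxB23 q 2))))

def ww {A : Type*} [CommRing A] (w₁ w₂ : Fin 6 → Fin 6 → Fin 6 → A) : A :=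
  ∑ q, sg33 q • (w₁ (idxA33 q 0) (idxA33 q 1) (idxA33 q 2) *
      w₂ (idxB33 q 0) (idxB33 q 1) (idxB33 q 2))

section
variable {W : Type*} [AddCommGroup W] [Module ℝ W]

def co (b : Fin 6 → W) (Ω : AlternatingMap ℝ W ℝ (Fin 3)) (i j k : Fin 6) : ℝ :=
  Ω ![b i, b j, b k]

theorem comp3 {X Y : Type*} (f : X → Y) (g : Fin 3 → X) : f ∘ g = ![f (g 0), f (g 1), f (g 2)] := by
  funext i; fin_cases i <;> rfl

theorem comp2 {X Y : Type*} (f : X → Y) (g : Fin 2 → X) : f ∘ g = ![f (g 0), f (g 1)] := by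
  funext i; fin_cases i <;> rfl

theorem wedge33_co (b : Fin 6 → W) (Ω₁ Ω₂ : AlternatingMap ℝ W ℝ (Fin 3)) :
    wedge Ω₁ Ω₂ b = ww (co b Ω₁) (co b Ω₂) := by
  rw [wedge33]
  simp only [comp3, ww, co]

theorem kk_co (b : Module.Basis (Fin 6) ℝ W) (Ω₁ Ω₂ : AlternatingMap ℝ W ℝ (Fin 3)) (i j : Fin 6) :
    wedge (oneForm (b.coord i)) (wedge (Ω₁.curryLeft (b j)) Ω₂) b =
      kk (co b Ω₁) (co b Ω₂) i j := by
  rw [wedge15]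
  simp only [wedge23]
  simp only [comp3, comp2, kk, co, oneForm, AlternatingMap.curryLeft_apply_apply,
    AlternatingMap.ofSubsingleton_apply_apply, Function.comp, Module.Basis.coord_apply,
    Module.Basis.repr_self, Finsupp.single_apply]

theorem co_swap1 (b : Fin 6 → W) (Ω : AlternatingMap ℝ W ℝ (Fin 3)) (i j k : Fin 6) :
    co b Ω i j k = - co b Ω j i k := by
  have h := Ω.map_swap ![b i, b j, b k] (i := 0) (j := 1) (by decide)
  have h2 : (![b i, b j, b k] ∘ (Equiv.swap (0 : Fin 3) 1)) = ![b j, b i, b k] := by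
    funext x; fin_cases x <;> rfl
  rw [h2] at h
  simp only [co, h, neg_neg]

theorem co_swap2 (b : Fin 6 → W) (Ω : AlternatingMap ℝ W ℝ (Fin 3)) (i j k : Fin 6) :
    co b Ω i j k = - co b Ω i k j := by
  have h := Ω.map_swap ![b i, b j, b k] (i := 1) (j := 2) (by decide)
  have h2 : (![b i, b j, b k] ∘ (Equiv.swap (1 : Fin 3) 2)) = ![b i, b k, b j] := by
    funext x; fin_cases x <;> rfl
  rw [h2] at h
  simp only [co, h, neg_neg]

end

/-- standard coordinate values of `z₁, z₂, z₃` on the basis -/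
def GG : Fin 3 → Fin 6 → GaussianInt :=
  ![![1, ⟨0, 1⟩, 0, 0, 0, 0], ![0, 0, 1, ⟨0, 1⟩, 0, 0], ![0, 0, 0, 0, 1, ⟨0, 1⟩]]

def dG (i j k : Fin 6) : GaussianInt :=
  det3 (fun x => GG 0 (![i, j, k] x)) (fun x => GG 1 (![i, j, k] x)) (fun x => GG 2 (![i, j, k] x))

def reZ (i j k : Fin 6) : ℤ := (dG i j k).re
def imZ (i j k : Fin 6) : ℤ := (dG i j k).im

def J0 : Fin 6 → Fin 6 → ℤ :=
  ![![0, 2, 0, 0, 0, 0], ![-2, 0, 0, 0, 0, 0], ![0, 0, 0, 2, 0, 0], ![0, 0, -2, 0, 0, 0],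
    ![0, 0, 0, 0, 0, 2], ![0, 0, 0, 0, -2, 0]]

theorem kk_reZ : ∀ i j, kk reZ reZ i j = J0 i j := by decide +kernel

theorem ww_reim : ww reZ imZ = 4 := by decide +kernel

def reT : Fin 6 → Fin 6 → Fin 6 → ℤ :=
  ![![![0, 0, 0, 0, 0, 0], ![0, 0, 0, 0, 0, 0], ![0, 0, 0, 0, 1, 0], ![0, 0, 0, 0, 0, -1], ![0, 0, -1, 0, 0, 0], ![0, 0, 0, 1, 0, 0]],
    ![![0, 0, 0, 0, 0, 0], ![0, 0, 0, 0, 0, 0], ![0, 0, 0, 0, 0, -1], ![0, 0, 0, 0, -1, 0], ![0, 0, 0, 1, 0, 0], ![0, 0, 1, 0, 0, 0]],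
    ![![0, 0, 0, 0, -1, 0], ![0, 0, 0, 0, 0, 1], ![0, 0, 0, 0, 0, 0], ![0, 0, 0, 0, 0, 0], ![1, 0, 0, 0, 0, 0], ![0, -1, 0, 0, 0, 0]],
    ![![0, 0, 0, 0, 0, 1], ![0, 0, 0, 0, 1, 0], ![0, 0, 0, 0, 0, 0], ![0, 0, 0, 0, 0, 0], ![0, -1, 0, 0, 0, 0], ![-1, 0, 0, 0, 0, 0]],
    ![![0, 0, 1, 0, 0, 0], ![0, 0, 0, -1, 0, 0], ![-1, 0, 0, 0, 0, 0], ![0, 1, 0, 0, 0, 0], ![0, 0, 0, 0, 0, 0], ![0, 0, 0, 0, 0, 0]],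
    ![![0, 0, 0, -1, 0, 0], ![0, 0, -1, 0, 0, 0], ![0, 1, 0, 0, 0, 0], ![1, 0, 0, 0, 0, 0], ![0, 0, 0, 0, 0, 0], ![0, 0, 0, 0, 0, 0]]]

theorem reZ_eq : ∀ i j k, reZ i j k = reT i j k := by decide +kernel

def imT : Fin 6 → Fin 6 → Fin 6 → ℤ :=
  ![![![0, 0, 0, 0, 0, 0], ![0, 0, 0, 0, 0, 0], ![0, 0, 0, 0, 0, 1], ![0, 0, 0, 0, 1, 0], ![0, 0, 0, -1, 0, 0], ![0, 0, -1, 0, 0, 0]],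
    ![![0, 0, 0, 0, 0, 0], ![0, 0, 0, 0, 0, 0], ![0, 0, 0, 0, 1, 0], ![0, 0, 0, 0, 0, -1], ![0, 0, -1, 0, 0, 0], ![0, 0, 0, 1, 0, 0]],
    ![![0, 0, 0, 0, 0, -1], ![0, 0, 0, 0, -1, 0], ![0, 0, 0, 0, 0, 0], ![0, 0, 0, 0, 0, 0], ![0, 1, 0, 0, 0, 0], ![1, 0, 0, 0, 0, 0]],
    ![![0, 0, 0, 0, -1, 0], ![0, 0, 0, 0, 0, 1], ![0, 0, 0, 0, 0, 0], ![0, 0, 0, 0, 0, 0], ![1, 0, 0, 0, 0, 0], ![0, -1, 0, 0, 0, 0]],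
    ![![0, 0, 0, 1, 0, 0], ![0, 0, 1, 0, 0, 0], ![0, -1, 0, 0, 0, 0], ![-1, 0, 0, 0, 0, 0], ![0, 0, 0, 0, 0, 0], ![0, 0, 0, 0, 0, 0]],
    ![![0, 0, 1, 0, 0, 0], ![0, 0, 0, -1, 0, 0], ![-1, 0, 0, 0, 0, 0], ![0, 1, 0, 0, 0, 0], ![0, 0, 0, 0, 0, 0], ![0, 0, 0, 0, 0, 0]]]

theorem imZ_eq : ∀ i j k, imZ i j k = imT i j k := by decide +kernel

theorem kk_eq (w₁ w₂ : Fin 6 → Fin 6 → Fin 6 → ℝ) (p j : Fin 6) :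
    kk w₁ w₂ p j = sg15 p • ∑ q, sg23 q •
      (w₁ j (idxB15 p (idxA23 q 0)) (idxB15 p (idxA23 q 1)) *
      w₂ (idxB15 p (idxB23 q 0)) (idxB15 p (idxB23 q 1)) (idxB15 p (idxB23 q 2))) := by
  unfold kk
  rw [Finset.sum_eq_single p]
  · have : idxA15 p 0 = p := by revert p; decide
    simp [this]
  · intro x _ hx
    have : ∀ x, idxA15 x 0 = x := by decide
    simp [this, hx]
  · simp

theorem key (w : Fin 6 → Fin 6 → Fin 6 → ℝ) (h1 : ∀ i j k, w i j k = - w j i k)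
    (h2 : ∀ i j k, w i j k = - w i k j) :
    ∑ i, ∑ j, (J0 i j : ℝ) * (kk (fun i j k => (reZ i j k : ℝ)) w j i +
      kk w (fun i j k => (reZ i j k : ℝ)) j i) =
    12 * ww (fun i j k => (imZ i j k : ℝ)) w := by
  have h1' : ∀ i j k, j < i → w i j k = - w j i k := fun i j k _ => h1 i j k
  have h2' : ∀ i j k, k < j → w i j k = - w i k j := fun i j k _ => h2 i j k
  clear h1 h2
  simp only [reZ_eq, imZ_eq]
  have hJ : ∀ f : Fin 6 → Fin 6 → ℝ, ∑ i, ∑ j, (J0 i j : ℝ) * f j i =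
      2 * f 1 0 - 2 * f 0 1 + 2 * f 3 2 - 2 * f 2 3 + 2 * f 5 4 - 2 * f 4 5 := by
    intro f
    simp [J0, Fin.sum_univ_succ]
    ring_nf
  rw [hJ (fun j i => kk (fun i j k => (reT i j k : ℝ)) w j i +
      kk w (fun i j k => (reT i j k : ℝ)) j i)]
  have e1 : ∀ f : Fin 10 → ℝ, ∑ i, f i = f 0 + f 1 + f 2 + f 3 + f 4 + f 5 + f 6 + f 7 + f 8 + f 9 := by
    intro f; simp [Fin.sum_univ_succ]; ring_nf
  have e2 : ∀ f : Fin 20 → ℝ, ∑ i, f i = f 0 + f 1 + f 2 + f 3 + f 4 + f 5 + f 6 + f 7 + f 8 + f 9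
     + f 10 + f 11 + f 12 + f 13 + f 14 + f 15 + f 16 + f 17 + f 18 + f 19 := by
    intro f; simp [Fin.sum_univ_succ]; ring_nf
  simp only [kk_eq, ww, e1, e2]
  simp [sg15, sg23, sg33, idxB15, idxA23, idxB23, idxA33, idxB33, reT, imT]
  simp [h1', h2']
  ring

theorem kk_line (w u : Fin 6 → Fin 6 → Fin 6 → ℝ) (t : ℝ) (i j : Fin 6) :
    kk (fun a b c => w a b c + t * u a b c) (fun a b c => w a b c + t * u a b c) i j =
      kk w w i j + t * (kk w u i j + kk u w i j) + t ^ 2 * kk u u i j := by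
  simp only [kk_eq, Units.smul_def, zsmul_eq_mul, Finset.mul_sum, ← Finset.sum_add_distrib]
  refine Finset.sum_congr rfl fun q _ => ?_
  ring

theorem kk_cast (i j : Fin 6) :
    kk (fun a b c => (reZ a b c : ℝ)) (fun a b c => (reZ a b c : ℝ)) i j = (J0 i j : ℝ) := by
  rw [← kk_reZ]
  simp only [kk, Units.smul_def, zsmul_eq_mul]
  push_cast
  rfl

theorem ww_cast :
    ww (fun a b c => (reZ a b c : ℝ)) (fun a b c => (imZ a b c : ℝ)) = 4 := by
  have h : ((ww reZ imZ : ℤ) : ℝ) = 4 := by rw [ww_reim]; norm_num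
  rw [← h]
  simp only [ww, Units.smul_def, zsmul_eq_mul]
  push_cast
  rfl

theorem J0_tr : ∑ i, ∑ j, (J0 i j : ℝ) * J0 j i = -24 := by
  have h : ∑ i, ∑ j, J0 i j * J0 j i = -24 := by decide
  exact_mod_cast h

theorem exists_std_basis {W : Type*} [AddCommGroup W] [Module ℝ W] [FiniteDimensional ℝ W]
    (hdim : Module.finrank ℝ W = 6) (ξ : Fin 3 → W →ₗ[ℝ] ℂ)
    (hinj : ∀ v, (∀ a, ξ a v = 0) → v = 0) :
    ∃ b : Module.Basis (Fin 6) ℝ W, ∀ a i, ξ a (b i) = GaussianInt.toComplex (GG a i) := by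
  have hL : Function.Injective (LinearMap.pi ξ) := by
    rw [injective_iff_map_eq_zero]
    intro v hv
    exact hinj v fun a => congrFun hv a
  have hfr : Module.finrank ℝ W = Module.finrank ℝ (Fin 3 → ℂ) := by
    rw [hdim, Module.finrank_pi_fintype]
    simp [Complex.finrank_real_complex]
  let L := LinearEquiv.ofInjectiveOfFinrankEq (LinearMap.pi ξ) hL hfr
  have hLa : ∀ v a, L v a = ξ a v := fun v a => rfl
  let u : Fin 6 → (Fin 3 → ℂ) := fun i a => GaussianInt.toComplex (GG a i)
  have hu : LinearIndependent ℝ (fun i => L.symm (u i)) := by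
    rw [Fintype.linearIndependent_iff]
    intro g hg
    have hg' : ∑ i, g i • u i = 0 := by
      have := congrArg L hg
      simpa using this
    have h0 := congrFun hg' 0
    have h1 := congrFun hg' 1
    have h2 := congrFun hg' 2
    simp [u, Fin.sum_univ_succ, GG, GaussianInt.toComplex_def, Complex.ext_iff] at h0 h1 h2
    intro i
    fin_cases i
    · exact h0.1
    · exact h0.2
    · exact h1.1
    · exact h1.2
    · exact h2.1
    · exact h2.2
  refine ⟨basisOfLinearIndependentOfCardEqFinrank hu (by simp [hdim]), fun a i => ?_⟩
  rw [coe_basisOfLinearIndependentOfCardEqFinrank, ← hLa]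
  simp [u]

theorem det3_zero {A : Type*} [CommRing A] (p q r : Fin 3 → A) (x : Fin 3) (hp : p x = 0)
    (hq : q x = 0) (hr : r x = 0) : det3 p q r = 0 := by
  fin_cases x <;> simp at hp hq hr <;> simp [det3, hp, hq, hr]

theorem top_form_update {W : Type*} [AddCommGroup W] [Module ℝ W]
    (b : Module.Basis (Fin 6) ℝ W) (ε : AlternatingMap ℝ W ℝ (Fin 6)) (k : Fin 6) (v : W) :
    ε (Function.update b k v) = ε b * b.coord k v := by
  have h : ε.toMultilinearMap.toLinearMap b k = ε b • b.coord k := by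
    refine b.ext fun i => ?_
    by_cases hik : i = k
    · subst hik
      simp
    · have : ε (Function.update b k (b i)) = 0 :=
        ε.map_eq_zero_of_eq (i := i) (j := k) _ (by simp [Function.update_of_ne hik]) hik
      simp [this, Finsupp.single_apply, hik]
  have := LinearMap.congr_fun h v
  simpa using this

theorem wedge33_zero {W : Type*} [AddCommGroup W] [Module ℝ W]
    (α β : AlternatingMap ℝ W ℝ (Fin 3)) (v : W)
    (hα : ∀ (u : Fin 3 → W) x, u x = v → α u = 0) (hβ : ∀ (u : Fin 3 → W) x, u x = v → β u = 0)
    (u : Fin 6 → W) (k : Fin 6) (hk : u k = v) : wedge α β u = 0 := by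
  rw [wedge33]
  refine Finset.sum_eq_zero fun q _ => ?_
  have h : ∀ q k, (∃ x, idxA33 q x = k) ∨ (∃ x, idxB33 q x = k) := by decide +kernel
  rcases h q k with ⟨x, hx⟩ | ⟨x, hx⟩
  · rw [hα (u ∘ idxA33 q) x (by simp [hx, hk])]; simp
  · rw [hβ (u ∘ idxB33 q) x (by simp [hx, hk])]; simp

theorem std_form {W : Type*} [AddCommGroup W] [Module ℝ W] [FiniteDimensional ℝ W]
    (hdim : Module.finrank ℝ W = 6)
    (ε : AlternatingMap ℝ W ℝ (Fin 6)) (hε : ε ≠ 0)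
    (Ω Ωh : AlternatingMap ℝ W ℝ (Fin 3))
    (hdec : IsDecomposable (cx Ω + Complex.I • cx Ωh))
    (c : ℝ) (hc : 0 < c) (hw : wedge Ω Ωh = c • ε) :
    ∃ b : Module.Basis (Fin 6) ℝ W, 0 < ε b ∧
      co b Ω = (fun i j k => (reZ i j k : ℝ)) ∧ co b Ωh = (fun i j k => (imZ i j k : ℝ)) := by
  obtain ⟨p, q, r, h⟩ := hdec
  have hval : ∀ u : Fin 3 → W, (Ω u : ℂ) + Complex.I * (Ωh u : ℂ) =
      det3 (fun i => p (u i)) (fun i => q (u i)) (fun i => r (u i)) := by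
    intro u
    rw [← decomp_apply, ← h]
    simp [cx]
  have hre : ∀ u : Fin 3 → W, Ω u =
      (det3 (fun i => p (u i)) (fun i => q (u i)) (fun i => r (u i))).re := by
    intro u; rw [← hval]; simp
  have him : ∀ u : Fin 3 → W, Ωh u =
      (det3 (fun i => p (u i)) (fun i => q (u i)) (fun i => r (u i))).im := by
    intro u; rw [← hval]; simp
  have hinj : ∀ v, (∀ a, (![p, q, r] : Fin 3 → W →ₗ[ℝ] ℂ) a v = 0) → v = 0 := by
    intro v hv
    have hp : p v = 0 := hv 0
    have hq : q v = 0 := hv 1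
    have hr : r v = 0 := hv 2
    let b0 : Module.Basis (Fin 6) ℝ W := Module.finBasisOfFinrankEq ℝ W hdim
    have hb0 : ε b0 ≠ 0 := by
      intro h0
      apply hε
      rw [ε.eq_smul_basis_det b0, h0, zero_smul]
    refine b0.ext_elem fun k => ?_
    have hz : wedge Ω Ωh (Function.update b0 k v) = 0 := by
      refine wedge33_zero Ω Ωh v ?_ ?_ _ k (by simp)
      · intro u x hx
        rw [hre, det3_zero _ _ _ x (by simp [hx, hp]) (by simp [hx, hq]) (by simp [hx, hr])]
        rfl
      · intro u x hx
        rw [him, det3_zero _ _ _ x (by simp [hx, hp]) (by simp [hx, hq]) (by simp [hx, hr])]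
        rfl
    rw [hw, AlternatingMap.smul_apply, top_form_update] at hz
    simpa [hc.ne', hb0] using hz
  obtain ⟨b, hb⟩ := exists_std_basis hdim _ hinj
  have hbp : ∀ i, p (b i) = GaussianInt.toComplex (GG 0 i) := fun i => hb 0 i
  have hbq : ∀ i, q (b i) = GaussianInt.toComplex (GG 1 i) := fun i => hb 1 i
  have hbr : ∀ i, r (b i) = GaussianInt.toComplex (GG 2 i) := fun i => hb 2 i
  have hd : ∀ i j k, det3 (fun x => p (![b i, b j, b k] x)) (fun x => q (![b i, b j, b k] x))
      (fun x => r (![b i, b j, b k] x)) = GaussianInt.toComplex (dG i j k) := by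
    intro i j k
    simp [det3, dG, hbp, hbq, hbr]
  have h1 : co b Ω = (fun i j k => (reZ i j k : ℝ)) := by
    funext i j k
    rw [co, hre, hd, reZ, GaussianInt.intCast_re]
  have h2 : co b Ωh = (fun i j k => (imZ i j k : ℝ)) := by
    funext i j k
    rw [co, him, hd, imZ, GaussianInt.intCast_im]
  refine ⟨b, ?_, h1, h2⟩
  have h3 := wedge33_co b Ω Ωh
  rw [h1, h2, ww_cast, hw, AlternatingMap.smul_apply, smul_eq_mul] at h3
  by_contra hneg
  nlinarith

/-- The function `φ(Ω) = √(−λ(Ω))` is differentiable on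
`U = {λ < 0}` and its derivative satisfies `Dφ_Ω(Ω̇)·ε = −Ω̂ ∧ Ω̇`.
Differentiability is expressed after transporting `Λ³W*` to `ℝ²⁰` by an
arbitrary linear coordinate isomorphism `e` (any such identification gives the
same notion, the space being 20-dimensional by `hdim`). -/
theorem stmt10 (W : Type*) [AddCommGroup W] [Module ℝ W] [FiniteDimensional ℝ W]
    (hdim : Module.finrank ℝ W = 6)
    (ε : AlternatingMap ℝ W ℝ (Fin 6)) (hε : ε ≠ 0)
    (K : AlternatingMap ℝ W ℝ (Fin 3) → W →ₗ[ℝ] W)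
    (hK : ∀ (Ω : AlternatingMap ℝ W ℝ (Fin 3)) (θ : W →ₗ[ℝ] ℝ) (v : W),
      wedge (oneForm θ) (wedge (Ω.curryLeft v) Ω) = θ (K Ω v) • ε)
    (lam : AlternatingMap ℝ W ℝ (Fin 3) → ℝ)
    (hlam : ∀ Ω, lam Ω = (6 : ℝ)⁻¹ * LinearMap.trace ℝ W (K Ω ∘ₗ K Ω))
    (hat : AlternatingMap ℝ W ℝ (Fin 3) → AlternatingMap ℝ W ℝ (Fin 3))
    (hhat : ∀ Ω, lam Ω < 0 →
      IsDecomposable (cx Ω + Complex.I • cx (hat Ω)) ∧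
        ∃ c : ℝ, 0 < c ∧ wedge Ω (hat Ω) = c • ε)
    (e : AlternatingMap ℝ W ℝ (Fin 3) ≃ₗ[ℝ] (Fin 20 → ℝ))
    (Ω : AlternatingMap ℝ W ℝ (Fin 3)) (hΩ : lam Ω < 0) :
    ∃ D : (Fin 20 → ℝ) →L[ℝ] ℝ,
      HasFDerivAt (fun x => Real.sqrt (-lam (e.symm x))) D (e Ω) ∧
        ∀ Ωdot : AlternatingMap ℝ W ℝ (Fin 3),
          D (e Ωdot) • ε = -wedge (hat Ω) Ωdot := by
  obtain ⟨hdec, c, hc, hw⟩ := hhat Ω hΩ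
  obtain ⟨b, hE, hb1, hb2⟩ := std_form hdim ε hε Ω (hat Ω) hdec c hc hw
  have hE0 : ε b ≠ 0 := hE.ne'
  have hKe : ∀ ω i j, b.coord i (K ω (b j)) = kk (co b ω) (co b ω) i j / ε b := by
    intro ω i j
    have h := congrArg (fun f => f b) (hK ω (b.coord i) (b j))
    simp only [kk_co, AlternatingMap.smul_apply, smul_eq_mul] at h
    rw [h, mul_div_cancel_right₀ _ hE0]
  have hlamE : ∀ ω, lam ω = (6 * ε b ^ 2)⁻¹ *
      ∑ i, ∑ j, kk (co b ω) (co b ω) i j * kk (co b ω) (co b ω) j i := by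
    intro ω
    rw [hlam, LinearMap.trace_eq_matrix_trace ℝ b, LinearMap.toMatrix_comp b b b, mul_inv, mul_assoc]
    congr 1
    simp only [Matrix.trace, Matrix.diag, Matrix.mul_apply, LinearMap.toMatrix_apply,
      ← Module.Basis.coord_apply, hKe, Finset.mul_sum]
    refine Finset.sum_congr rfl fun i _ => Finset.sum_congr rfl fun j _ => ?_
    field_simp
  have hlam0 : lam Ω = -4 / ε b ^ 2 := by
    rw [hlamE, hb1]
    simp only [kk_cast, J0_tr]
    field_simp
    norm_num
  have hsqrt : Real.sqrt (-lam Ω) = 2 / ε b := by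
    rw [hlam0, show -(-4 / ε b ^ 2) = (2 / ε b) ^ 2 by field_simp; norm_num]
    exact Real.sqrt_sq (by positivity)
  -- differentiability
  have hco : ∀ i j k, Differentiable ℝ (fun x : Fin 20 → ℝ => co b (e.symm x) i j k) := by
    intro i j k
    let l : (Fin 20 → ℝ) →ₗ[ℝ] ℝ :=
      { toFun := fun x => co b (e.symm x) i j k
        map_add' := by intro x y; simp [co]
        map_smul' := by intro x y; simp [co] }
    exact (LinearMap.toContinuousLinearMap l).differentiable
  have hkk : ∀ i j, Differentiable ℝ
      (fun x : Fin 20 → ℝ => kk (co b (e.symm x)) (co b (e.symm x)) i j) := by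
    intro i j
    simp only [kk_eq, Units.smul_def, zsmul_eq_mul]
    fun_prop
  have hdl : Differentiable ℝ (fun x : Fin 20 → ℝ => lam (e.symm x)) := by
    simp only [hlamE]
    fun_prop
  have hdiff : DifferentiableAt ℝ (fun x => Real.sqrt (-lam (e.symm x))) (e Ω) := by
    refine DifferentiableAt.sqrt (hdl _).neg ?_
    simp only [LinearEquiv.symm_apply_apply]
    linarith
  refine ⟨_, hdiff.hasFDerivAt, fun Ωdot => ?_⟩
  set D := fderiv ℝ (fun x => Real.sqrt (-lam (e.symm x))) (e Ω) with hD
  have hcol : ∀ t : ℝ, co b (Ω + t • Ωdot) =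
      fun i j k => co b Ω i j k + t * co b Ωdot i j k := by
    intro t; funext i j k; simp [co]
  set T := ww (co b (hat Ω)) (co b Ωdot) with hT
  have hlin : HasDerivAt (fun t : ℝ => lam (Ω + t • Ωdot)) (4 * T / ε b ^ 2) 0 := by
    have hk : ∀ i j, HasDerivAt
        (fun t : ℝ => kk (co b (Ω + t • Ωdot)) (co b (Ω + t • Ωdot)) i j)
        (kk (co b Ω) (co b Ωdot) i j + kk (co b Ωdot) (co b Ω) i j) 0 := by
      intro i j
      simp only [hcol, kk_line]
      have h := (((hasDerivAt_id (0 : ℝ)).mul_const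
        (kk (co b Ω) (co b Ωdot) i j + kk (co b Ωdot) (co b Ω) i j)).const_add
          (kk (co b Ω) (co b Ω) i j)).add
        (((hasDerivAt_id (0 : ℝ)).pow 2).mul_const (kk (co b Ωdot) (co b Ωdot) i j))
      refine HasDerivAt.congr_deriv h ?_
      simp
    simp only [hlamE]
    have h := (HasDerivAt.fun_sum (u := Finset.univ) fun i _ =>
      HasDerivAt.fun_sum (u := Finset.univ) fun j _ => (hk i j).mul (hk j i)).const_mul
        ((6 * ε b ^ 2)⁻¹)
    refine HasDerivAt.congr_deriv h ?_
    simp only [zero_smul, add_zero, Finset.sum_add_distrib]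
    have key' := key (co b Ωdot) (co_swap1 b Ωdot) (co_swap2 b Ωdot)
    rw [← hb1, ← hb2, ← hT] at key'
    have hJ : ∀ i j, kk (co b Ω) (co b Ω) i j = (J0 i j : ℝ) := by
      intro i j; rw [hb1, kk_cast]
    simp only [hJ]
    have hsw : ∑ i, ∑ j, (kk (co b Ω) (co b Ωdot) i j + kk (co b Ωdot) (co b Ω) i j) *
        (J0 j i : ℝ) = 12 * T := by
      rw [← key', Finset.sum_comm]
      refine Finset.sum_congr rfl fun i _ => Finset.sum_congr rfl fun j _ => mul_comm _ _
    rw [hsw, key']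
    field_simp
    ring
  have hline : HasDerivAt (fun t : ℝ => e Ω + t • e Ωdot) (e Ωdot) 0 := by
    simpa using ((hasDerivAt_id (0 : ℝ)).smul_const (e Ωdot)).const_add (e Ω)
  have hcomp : HasDerivAt (fun t : ℝ => Real.sqrt (-lam (Ω + t • Ωdot))) (D (e Ωdot)) 0 := by
    have h1 : HasFDerivAt (fun x => Real.sqrt (-lam (e.symm x))) D (e Ω + (0 : ℝ) • e Ωdot) := by
      simpa using hdiff.hasFDerivAt
    have h := h1.comp_hasDerivAt (0 : ℝ) hline
    simpa [Function.comp_def] using h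
  have hcomp2 := hlin.neg.sqrt (by simpa using hΩ.ne)
  have hDval : D (e Ωdot) = - T / ε b := by
    rw [hcomp.unique hcomp2]
    simp only [Pi.neg_apply, zero_smul, add_zero, hsqrt]
    field_simp
    ring
  rw [(D (e Ωdot) • ε).eq_smul_basis_det b, (-wedge (hat Ω) Ωdot).eq_smul_basis_det b]
  congr 1
  rw [AlternatingMap.smul_apply, AlternatingMap.neg_apply, wedge33_co, ← hT, hDval, smul_eq_mul]
  field_simp
end
end

section
/- The map Ω ↦ Ω̂ is smooth on the open set U, and for each Ω ∈ U the linear map J_Ω : Λ³W* → Λ³W* defined as the derivative at Ω of the map Ω' ↦ −Ω̂' satisfies J_Ω ∘ J_Ω = −id. Hence J defines an almost complex structure on the 20-dimensional open set U. -/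
open scoped TensorProduct

noncomputable section

/-- The wedge of `n` covectors, as the alternatization of their product. -/
def DD {A M : Type*} [CommRing A] [Algebra ℝ A] [AddCommGroup M] [Module ℝ M] {n : ℕ}
    (ξ : Fin n → (M →ₗ[ℝ] A)) : AlternatingMap ℝ M A (Fin n) :=
  MultilinearMap.alternatization ((MultilinearMap.mkPiAlgebra ℝ (Fin n) A).compLinearMap ξ)

section DDsec

variable {A M : Type*} [CommRing A] [Algebra ℝ A] [AddCommGroup M] [Module ℝ M]

theorem DD_apply {n : ℕ} (ξ : Fin n → (M →ₗ[ℝ] A)) (v : Fin n → M) :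
    DD ξ v = (Matrix.of fun i j => ξ j (v i)).det := by
  rw [DD, MultilinearMap.alternatization_apply, Matrix.det_apply]
  rfl

theorem oneForm_eq_DD (ξ : M →ₗ[ℝ] A) : oneForm ξ = DD ![ξ] := by
  ext v
  simp [DD_apply, oneForm]

theorem DD_zero_of_eq {n : ℕ} (ξ : Fin n → (M →ₗ[ℝ] A)) (i j : Fin n) (hij : i ≠ j)
    (h : ξ i = ξ j) : DD ξ = 0 := by
  ext v
  rw [DD_apply]
  exact Matrix.det_zero_of_column_eq hij (by intro k; simp [h])

theorem wedge_DD {m n : ℕ} (ξ : Fin m → (M →ₗ[ℝ] A)) (η : Fin n → (M →ₗ[ℝ] A)) :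
    wedge (DD ξ) (DD η) = DD (Fin.append ξ η) := by
  ext v
  rw [wedge, DD, DD, ← MultilinearMap.domCoprod_alternization, DD]
  simp only [LinearMap.compAlternatingMap_apply, AlternatingMap.domDomCongr_apply,
    MultilinearMap.alternatization_apply, map_sum]
  refine Fintype.sum_equiv finSumFinEquiv.permCongr _ _ ?_
  intro σ
  simp only [Equiv.Perm.sign_permCongr]
  rw [map_zsmul_unit]
  congr 1
  simp only [MultilinearMap.domDomCongr_apply, MultilinearMap.domCoprod_apply, LinearMap.mul'_apply,
    MultilinearMap.compLinearMap_apply, MultilinearMap.mkPiAlgebra_apply, Fin.prod_univ_add]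
  simp [Equiv.permCongr_apply]

theorem wedge_add_left {m n : ℕ} (α α' : AlternatingMap ℝ M A (Fin m))
    (β : AlternatingMap ℝ M A (Fin n)) : wedge (α + α') β = wedge α β + wedge α' β := by
  ext v
  have := congrArg (fun f : AlternatingMap ℝ M (A ⊗[ℝ] A) (Fin m ⊕ Fin n) =>
    f (v ∘ finSumFinEquiv)) 
    (show (AlternatingMap.domCoprod' ((α + α') ⊗ₜ β)) = AlternatingMap.domCoprod' (α ⊗ₜ β)
      + AlternatingMap.domCoprod' (α' ⊗ₜ[ℝ] β) by rw [TensorProduct.add_tmul, map_add])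
  simp only [AlternatingMap.domCoprod'_apply] at this
  simp only [wedge, LinearMap.compAlternatingMap_apply, AlternatingMap.domDomCongr_apply,
    AlternatingMap.add_apply]
  have h2 := congrArg (LinearMap.mul' ℝ A) this
  simpa using h2

theorem wedge_add_right {m n : ℕ} (α : AlternatingMap ℝ M A (Fin m))
    (β β' : AlternatingMap ℝ M A (Fin n)) : wedge α (β + β') = wedge α β + wedge α β' := by
  ext v
  have := congrArg (fun f : AlternatingMap ℝ M (A ⊗[ℝ] A) (Fin m ⊕ Fin n) =>
    f (v ∘ finSumFinEquiv)) 
    (show (AlternatingMap.domCoprod' (α ⊗ₜ (β + β'))) = AlternatingMap.domCoprod' (α ⊗ₜ β)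
      + AlternatingMap.domCoprod' (α ⊗ₜ[ℝ] β') by rw [TensorProduct.tmul_add, map_add])
  simp only [AlternatingMap.domCoprod'_apply] at this
  simp only [wedge, LinearMap.compAlternatingMap_apply, AlternatingMap.domDomCongr_apply,
    AlternatingMap.add_apply]
  have h2 := congrArg (LinearMap.mul' ℝ A) this
  simpa using h2

theorem wedge_apply_sum {m n : ℕ} (α : AlternatingMap ℝ M A (Fin m))
    (β : AlternatingMap ℝ M A (Fin n)) (v : Fin (m + n) → M) :
    wedge α β v = ∑ σ : Equiv.Perm.ModSumCongr (Fin m) (Fin n),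
      (LinearMap.mul' ℝ A) (AlternatingMap.domCoprod.summand α β σ (v ∘ finSumFinEquiv)) := by
  simp [wedge, AlternatingMap.domCoprod_apply, Function.comp_def, map_sum]

theorem summand_mul {m n : ℕ} (α : AlternatingMap ℝ M A (Fin m))
    (β : AlternatingMap ℝ M A (Fin n)) (σ : Equiv.Perm (Fin m ⊕ Fin n)) (v : Fin m ⊕ Fin n → M) :
    (LinearMap.mul' ℝ A) (AlternatingMap.domCoprod.summand α β (Quotient.mk _ σ) v) =
      Equiv.Perm.sign σ • (α (fun i => v (σ (Sum.inl i))) * β (fun i => v (σ (Sum.inr i)))) := by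
  rw [AlternatingMap.domCoprod.summand_mk'']
  simp [map_zsmul_unit]

theorem wedge_smul_left {m n : ℕ} (c : A) (α : AlternatingMap ℝ M A (Fin m))
    (β : AlternatingMap ℝ M A (Fin n)) : wedge (c • α) β = c • wedge α β := by
  ext v
  rw [AlternatingMap.smul_apply, wedge_apply_sum, wedge_apply_sum, Finset.smul_sum]
  refine Finset.sum_congr rfl fun σ _ => ?_
  induction σ using Quotient.inductionOn
  rw [summand_mul, summand_mul, smul_comm]
  simp [mul_assoc]

theorem wedge_smul_right {m n : ℕ} (c : A) (α : AlternatingMap ℝ M A (Fin m))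
    (β : AlternatingMap ℝ M A (Fin n)) : wedge α (c • β) = c • wedge α β := by
  ext v
  rw [AlternatingMap.smul_apply, wedge_apply_sum, wedge_apply_sum, Finset.smul_sum]
  refine Finset.sum_congr rfl fun σ _ => ?_
  induction σ using Quotient.inductionOn
  rw [summand_mul, summand_mul, smul_comm]
  simp [mul_left_comm]

theorem cx_wedge {m n : ℕ} (α : AlternatingMap ℝ M ℝ (Fin m))
    (β : AlternatingMap ℝ M ℝ (Fin n)) : cx (wedge α β) = wedge (cx α) (cx β) := by
  ext v
  rw [wedge_apply_sum, cx, LinearMap.compAlternatingMap_apply, wedge_apply_sum, map_sum]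
  refine Finset.sum_congr rfl fun σ _ => ?_
  induction σ using Quotient.inductionOn
  rw [summand_mul, summand_mul, map_zsmul_unit]
  simp [cx]

end DDsec

section keysec

variable {A M : Type*} [CommRing A] [Algebra ℝ A] [AddCommGroup M] [Module ℝ M]

theorem wedge_sub_left {m n : ℕ} (α α' : AlternatingMap ℝ M A (Fin m))
    (β : AlternatingMap ℝ M A (Fin n)) : wedge (α - α') β = wedge α β - wedge α' β := by
  have := wedge_add_left (α - α') α' β
  rw [sub_add_cancel] at this
  rw [this, add_sub_cancel_right]

theorem wedge_sub_right {m n : ℕ} (α : AlternatingMap ℝ M A (Fin m))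
    (β β' : AlternatingMap ℝ M A (Fin n)) : wedge α (β - β') = wedge α β - wedge α β' := by
  have := wedge_add_right α (β - β') β'
  rw [sub_add_cancel] at this
  rw [this, add_sub_cancel_right]

theorem DD_curryLeft (a b c : M →ₗ[ℝ] A) (v : M) :
    AlternatingMap.curryLeft (n := 2) (DD ![a, b, c]) v =
      a v • DD ![b, c] - b v • DD ![a, c] + c v • DD ![a, b] := by
  ext w
  simp [DD_apply, Matrix.det_fin_three, Matrix.det_fin_two]
  ring

theorem wedge33_s11 (a b c a' b' c' : M →ₗ[ℝ] A) :
    wedge (DD ![a, b, c]) (DD ![a', b', c']) = (DD ![a, b, c, a', b', c'] :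
      AlternatingMap ℝ M A (Fin 6)) := by
  rw [wedge_DD]
  congr 1
  funext i
  fin_cases i <;> rfl

theorem wedge123 (a b c a' b' c' : M →ₗ[ℝ] A) :
    wedge (oneForm a) (wedge (DD ![b, c]) (DD ![a', b', c'])) = (DD ![a, b, c, a', b', c'] :
      AlternatingMap ℝ M A (Fin 6)) := by
  rw [oneForm_eq_DD, wedge_DD, wedge_DD]
  congr 1
  funext i
  fin_cases i <;> rfl

theorem wedge111 (a b c : M →ₗ[ℝ] A) :
    wedge (oneForm a) (wedge (oneForm b) (oneForm c)) = (DD ![a, b, c] :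
      AlternatingMap ℝ M A (Fin 3)) := by
  rw [oneForm_eq_DD, oneForm_eq_DD, oneForm_eq_DD, wedge_DD, wedge_DD]
  congr 1
  funext i
  fin_cases i <;> rfl

theorem key_one (a b c a' b' c' : M →ₗ[ℝ] A) (v : M) :
    wedge (oneForm a) (wedge (AlternatingMap.curryLeft (n := 2) (DD ![a, b, c] + DD ![a', b', c']) v)
      (DD ![a, b, c] + DD ![a', b', c'])) = a v • DD ![a, b, c, a', b', c'] := by
  rw [AlternatingMap.curryLeft_add, LinearMap.add_apply, DD_curryLeft, DD_curryLeft]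
  simp only [wedge_add_left, wedge_add_right, wedge_sub_left, wedge_sub_right, wedge_smul_left,
    wedge_smul_right, wedge123]
  have h0 (x y z w p : M →ₗ[ℝ] A) : (DD ![x, x, y, z, w, p]) = 0 :=
    DD_zero_of_eq _ 0 1 (by decide) rfl
  have h1 (x y z w p : M →ₗ[ℝ] A) : (DD ![x, y, x, z, w, p]) = 0 :=
    DD_zero_of_eq _ 0 2 (by decide) rfl
  have h2 (x y z w p : M →ₗ[ℝ] A) : (DD ![x, y, z, x, w, p]) = 0 :=
    DD_zero_of_eq _ 0 3 (by decide) rfl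
  have h3 (x y z w p : M →ₗ[ℝ] A) : (DD ![x, y, z, y, w, p]) = 0 :=
    DD_zero_of_eq _ 1 3 (by decide) rfl
  have h4 (x y z w p : M →ₗ[ℝ] A) : (DD ![x, y, z, w, y, p]) = 0 :=
    DD_zero_of_eq _ 1 4 (by decide) rfl
  simp [h0, h2, h3, h4]

theorem wedge33_self (a b c : M →ₗ[ℝ] A) :
    wedge (DD ![a, b, c]) (DD ![a, b, c]) = 0 := by
  rw [wedge33_s11]
  exact DD_zero_of_eq _ 0 3 (by decide) rfl

theorem wedge33_swap (a b c a' b' c' : M →ₗ[ℝ] A) :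
    wedge (DD ![a', b', c']) (DD ![a, b, c]) = - wedge (DD ![a, b, c]) (DD ![a', b', c']) := by
  rw [wedge33_s11, wedge33_s11]
  ext v
  rw [AlternatingMap.neg_apply, DD_apply, DD_apply]
  have := Matrix.det_permute' (Equiv.swap (0 : Fin 6) 3 * Equiv.swap 1 4 * Equiv.swap 2 5)
    (Matrix.of fun i j => (![a, b, c, a', b', c'] : Fin 6 → (M →ₗ[ℝ] A)) j (v i))
  rw [show Equiv.Perm.sign (Equiv.swap (0 : Fin 6) 3 * Equiv.swap 1 4 * Equiv.swap 2 5) = -1 by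
    decide] at this
  simp only [Units.val_neg, Units.val_one, Int.cast_neg, Int.cast_one, neg_mul, one_mul] at this
  rw [← this]
  congr 1
  ext i j
  fin_cases j <;> rfl

theorem DD_cycle (a b c : M →ₗ[ℝ] A) : DD ![b, c, a] = DD ![a, b, c] := by
  ext w
  simp [DD_apply, Matrix.det_fin_three]
  ring

end keysec

/-- The conjugate of a complex covector. -/
def cj {M : Type*} [AddCommGroup M] [Module ℝ M] (ξ : M →ₗ[ℝ] ℂ) : M →ₗ[ℝ] ℂ :=
  Complex.conjAe.toLinearMap ∘ₗ ξ

section lemA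

variable {W : Type*} [AddCommGroup W] [Module ℝ W]

theorem cj_apply (ξ : W →ₗ[ℝ] ℂ) (v : W) : cj ξ v = (starRingEnd ℂ) (ξ v) := rfl

theorem cx_apply {n : ℕ} (Ω : AlternatingMap ℝ W ℝ (Fin n)) (v : Fin n → W) :
    cx Ω v = (Ω v : ℂ) := rfl

theorem cx_smul {n : ℕ} (r : ℝ) (Ω : AlternatingMap ℝ W ℝ (Fin n)) :
    cx (r • Ω) = (r : ℂ) • cx Ω := by
  ext v
  simp [cx_apply]

theorem wedge_smul_smul {m n : ℕ} (c d : ℂ) (α : AlternatingMap ℝ W ℂ (Fin m))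
    (β : AlternatingMap ℝ W ℂ (Fin n)) : wedge (c • α) (d • β) = (c * d) • wedge α β := by
  rw [wedge_smul_left, wedge_smul_right, smul_smul]

theorem wedge_smul_smul' {l m n : ℕ} (c d : ℂ) (γ : AlternatingMap ℝ W ℂ (Fin l))
    (α : AlternatingMap ℝ W ℂ (Fin m)) (β : AlternatingMap ℝ W ℂ (Fin n)) :
    wedge γ (wedge (c • α) (d • β)) = (c * d) • wedge γ (wedge α β) := by
  rw [wedge_smul_smul, wedge_smul_right]

theorem DD_conj (a b c : W →ₗ[ℝ] ℂ) (v : Fin 3 → W) :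
    DD ![cj a, cj b, cj c] v = (starRingEnd ℂ) (DD ![a, b, c] v) := by
  simp [DD_apply, Matrix.det_fin_three, cj_apply]

theorem conj_eq (Ω A : AlternatingMap ℝ W ℝ (Fin 3)) (a b c : W →ₗ[ℝ] ℂ)
    (h : cx Ω + Complex.I • cx A = DD ![a, b, c]) :
    cx Ω - Complex.I • cx A = DD ![cj a, cj b, cj c] := by
  ext v
  rw [DD_conj, ← h]
  simp [cx_apply, sub_eq_add_neg]

theorem oneForm_split (ξ : W →ₗ[ℝ] ℂ) :
    oneForm ξ = cx (oneForm (Complex.reLm ∘ₗ ξ)) +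
      Complex.I • cx (oneForm (Complex.imLm ∘ₗ ξ)) := by
  ext v
  simp [cx_apply, oneForm]
  rw [mul_comm]
  exact (Complex.re_add_im _).symm

theorem hK_cx (ε : AlternatingMap ℝ W ℝ (Fin 6)) (Ω : AlternatingMap ℝ W ℝ (Fin 3))
    (K : W →ₗ[ℝ] W)
    (hK : ∀ (θ : W →ₗ[ℝ] ℝ) (v : W),
      wedge (oneForm θ) (wedge (Ω.curryLeft v) Ω) = θ (K v) • ε)
    (ξ : W →ₗ[ℝ] ℂ) (v : W) :
    wedge (oneForm ξ) (wedge ((AlternatingMap.curryLeft (n := 2) (cx Ω)) v) (cx Ω)) =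
      ξ (K v) • cx ε := by
  have e1 : (AlternatingMap.curryLeft (n := 2) (cx Ω)) v = cx (Ω.curryLeft v) := rfl
  rw [e1, oneForm_split, wedge_add_left, wedge_smul_left, ← cx_wedge, ← cx_wedge, ← cx_wedge,
    hK, hK]
  ext w
  simp [cx_apply]
  conv_rhs => rw [← Complex.re_add_im (ξ (K v))]
  ring

theorem wedge_conj (ε : AlternatingMap ℝ W ℝ (Fin 6)) (Ω A : AlternatingMap ℝ W ℝ (Fin 3))
    (a b c : W →ₗ[ℝ] ℂ) (h : cx Ω + Complex.I • cx A = DD ![a, b, c])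
    (s : ℝ) (hs : wedge Ω A = s • ε) :
    DD ![a, b, c, cj a, cj b, cj c] = (-2 * Complex.I * s) • cx ε := by
  have h' := conj_eq Ω A a b c h
  have e1 : (2 : ℂ) • cx Ω = DD ![a, b, c] + DD ![cj a, cj b, cj c] := by
    rw [← h, ← h']; module
  have e2 : (2 * Complex.I) • cx A = DD ![a, b, c] - DD ![cj a, cj b, cj c] := by
    rw [← h, ← h']; module
  have e3 : wedge ((2 : ℂ) • cx Ω) ((2 * Complex.I) • cx A) =
      (-2 : ℂ) • DD ![a, b, c, cj a, cj b, cj c] := by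
    rw [e1, e2]
    simp only [wedge_add_left, wedge_sub_right, wedge33_self]
    rw [wedge33_swap a b c (cj a) (cj b) (cj c), ← wedge33_s11]
    module
  rw [wedge_smul_smul, ← cx_wedge] at e3
  replace e3 := (congrArg (fun x => ((2 : ℂ) * (2 * Complex.I)) • cx x) hs).symm.trans e3
  simp only [cx_smul] at e3
  have e4 := congrArg (fun x => (-1/2 : ℂ) • x) e3
  simp only [smul_smul] at e4
  rw [show (-1/2 : ℂ) * -2 = 1 by norm_num, one_smul] at e4
  rw [← e4]
  congr 1
  ring

theorem cx_ne_zero (ε : AlternatingMap ℝ W ℝ (Fin 6)) (hε : ε ≠ 0) :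
    ∃ v, cx ε v ≠ 0 := by
  by_contra hcon
  push Not at hcon
  apply hε
  ext v
  have := hcon v
  rw [cx_apply] at this
  exact_mod_cast this

theorem eig_one (ε : AlternatingMap ℝ W ℝ (Fin 6)) (hε : ε ≠ 0)
    (Ω A : AlternatingMap ℝ W ℝ (Fin 3)) (K : W →ₗ[ℝ] W)
    (hK : ∀ (θ : W →ₗ[ℝ] ℝ) (v : W),
      wedge (oneForm θ) (wedge (Ω.curryLeft v) Ω) = θ (K v) • ε)
    (a b c : W →ₗ[ℝ] ℂ) (h : cx Ω + Complex.I • cx A = DD ![a, b, c])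
    (s : ℝ) (hs : wedge Ω A = s • ε) (v : W) :
    a (K v) = -(Complex.I * s / 2) * a v := by
  have h' := conj_eq Ω A a b c h
  have e1 : (2 : ℂ) • cx Ω = DD ![a, b, c] + DD ![cj a, cj b, cj c] := by
    rw [← h, ← h']; module
  have k1 := key_one a b c (cj a) (cj b) (cj c) v
  rw [← e1] at k1
  have e2 : (AlternatingMap.curryLeft (n := 2) ((2 : ℂ) • cx Ω)) v =
      (2 : ℂ) • (AlternatingMap.curryLeft (n := 2) (cx Ω)) v := rfl
  rw [e2] at k1
  rw [wedge_smul_smul'] at k1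
  have k0 := hK_cx ε Ω K hK a v
  have k5 := wedge_conj ε Ω A a b c h s hs
  generalize wedge (oneForm a) (wedge ((AlternatingMap.curryLeft (n := 2) (cx Ω)) v) (cx Ω)) = X
    at k0 k1
  rw [k0, k5] at k1
  obtain ⟨w, hw⟩ := cx_ne_zero ε hε
  have k2 := congrArg (fun f : AlternatingMap ℝ W ℂ (Fin 6) => f w) k1
  simp only [AlternatingMap.smul_apply, smul_eq_mul] at k2
  have k3 : (4 * a (K v) + 2 * Complex.I * s * a v) * cx ε w = 0 := by linear_combination k2
  have k4 := (mul_eq_zero.mp k3).resolve_right hw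
  linear_combination k4 / 4

theorem eig_all (ε : AlternatingMap ℝ W ℝ (Fin 6)) (hε : ε ≠ 0)
    (Ω A : AlternatingMap ℝ W ℝ (Fin 3)) (K : W →ₗ[ℝ] W)
    (hK : ∀ (θ : W →ₗ[ℝ] ℝ) (v : W),
      wedge (oneForm θ) (wedge (Ω.curryLeft v) Ω) = θ (K v) • ε)
    (a b c : W →ₗ[ℝ] ℂ) (h : cx Ω + Complex.I • cx A = DD ![a, b, c])
    (s : ℝ) (hs : wedge Ω A = s • ε) (v : W) :
    a (K v) = -(Complex.I * s / 2) * a v ∧ b (K v) = -(Complex.I * s / 2) * b v ∧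
      c (K v) = -(Complex.I * s / 2) * c v := by
  refine ⟨eig_one ε hε Ω A K hK a b c h s hs v, ?_, ?_⟩
  · exact eig_one ε hε Ω A K hK b c a (by rw [DD_cycle]; exact h) s hs v
  · exact eig_one ε hε Ω A K hK c a b (by rw [DD_cycle, DD_cycle]; exact h) s hs v

theorem contract_eq (ε : AlternatingMap ℝ W ℝ (Fin 6)) (hε : ε ≠ 0)
    (Ω A : AlternatingMap ℝ W ℝ (Fin 3)) (K : W →ₗ[ℝ] W)
    (hK : ∀ (θ : W →ₗ[ℝ] ℝ) (v : W),
      wedge (oneForm θ) (wedge (Ω.curryLeft v) Ω) = θ (K v) • ε)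
    (a b c : W →ₗ[ℝ] ℂ) (h : cx Ω + Complex.I • cx A = DD ![a, b, c])
    (s : ℝ) (hs : wedge Ω A = s • ε) (u v w : W) :
    Ω ![K u, v, w] = s / 2 * A ![u, v, w] := by
  obtain ⟨h1, h2, h3⟩ := eig_all ε hε Ω A K hK a b c h s hs u
  have e1 : DD ![a, b, c] ![K u, v, w] = -(Complex.I * s / 2) * DD ![a, b, c] ![u, v, w] := by
    simp [DD_apply, Matrix.det_fin_three, h1, h2, h3]
    ring
  rw [← h] at e1
  have := congrArg Complex.re e1
  simpa [cx_apply] using this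

theorem inj_of (hdim : Module.finrank ℝ W = 6) [FiniteDimensional ℝ W]
    (ε : AlternatingMap ℝ W ℝ (Fin 6)) (hε : ε ≠ 0)
    (Ω A : AlternatingMap ℝ W ℝ (Fin 3))
    (a b c : W →ₗ[ℝ] ℂ) (h : cx Ω + Complex.I • cx A = DD ![a, b, c])
    (s : ℝ) (hs0 : s ≠ 0) (hs : wedge Ω A = s • ε) (v : W) (ha : a v = 0) (hb : b v = 0)
    (hc : c v = 0) : v = 0 := by
  by_contra hv
  obtain ⟨B, hB⟩ : ∃ B : Module.Basis (Fin 6) ℝ W, B 0 = v := by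
    have hli : LinearIndepOn ℝ id ({v} : Set W) := by
      rw [linearIndepOn_singleton_iff]
      exact hv
    let B0 := Module.Basis.extend hli
    have hmem : v ∈ hli.extend (Set.subset_univ _) := hli.subset_extend _ rfl
    have : Fintype (hli.extend (Set.subset_univ _)) := FiniteDimensional.fintypeBasisIndex B0
    have hcard : Fintype.card (hli.extend (Set.subset_univ _)) = 6 := by
      rw [← hdim, Module.finrank_eq_card_basis B0]
    let e0 := Fintype.equivFinOfCardEq hcard
    let e1 := e0.trans (Equiv.swap (e0 ⟨v, hmem⟩) 0)
    refine ⟨B0.reindex e1, ?_⟩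
    have : e1.symm 0 = ⟨v, hmem⟩ := by
      rw [Equiv.symm_apply_eq]
      simp [e1]
    rw [Module.Basis.reindex_apply, this]
    simp [B0]
  have hne := (AlternatingMap.map_basis_ne_zero_iff B ε).mpr hε
  have e1 := congrArg (fun f : AlternatingMap ℝ W ℂ (Fin 6) => f B)
    (wedge_conj ε Ω A a b c h s hs)
  simp only [AlternatingMap.smul_apply, smul_eq_mul, cx_apply] at e1
  have e2 : DD ![a, b, c, cj a, cj b, cj c] B = 0 := by
    rw [DD_apply]
    apply Matrix.det_eq_zero_of_row_eq_zero 0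
    intro j
    fin_cases j <;> simp [hB, ha, hb, hc, cj_apply]
  rw [e2] at e1
  simp [hs0, hne] at e1

theorem K_sq (hdim : Module.finrank ℝ W = 6) [FiniteDimensional ℝ W]
    (ε : AlternatingMap ℝ W ℝ (Fin 6)) (hε : ε ≠ 0)
    (Ω A : AlternatingMap ℝ W ℝ (Fin 3)) (K : W →ₗ[ℝ] W)
    (hK : ∀ (θ : W →ₗ[ℝ] ℝ) (v : W),
      wedge (oneForm θ) (wedge (Ω.curryLeft v) Ω) = θ (K v) • ε)
    (a b c : W →ₗ[ℝ] ℂ) (h : cx Ω + Complex.I • cx A = DD ![a, b, c])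
    (s : ℝ) (hs0 : s ≠ 0) (hs : wedge Ω A = s • ε) :
    (6 : ℝ)⁻¹ * LinearMap.trace ℝ W (K ∘ₗ K) = - (s / 2) ^ 2 := by
  have e1 : K ∘ₗ K = (- (s / 2) ^ 2) • LinearMap.id := by
    ext v
    rw [← sub_eq_zero]
    obtain ⟨h1, h2, h3⟩ := eig_all ε hε Ω A K hK a b c h s hs v
    obtain ⟨h1', h2', h3'⟩ := eig_all ε hε Ω A K hK a b c h s hs (K v)
    have hI : Complex.I ^ 2 = -1 := Complex.I_sq
    refine inj_of hdim ε hε Ω A a b c h s hs0 hs _ ?_ ?_ ?_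
    · simp [h1, h1']
      linear_combination (s : ℂ) ^ 2 / 4 * a v * hI
    · simp [h2, h2']
      linear_combination (s : ℂ) ^ 2 / 4 * b v * hI
    · simp [h3, h3']
      linear_combination (s : ℂ) ^ 2 / 4 * c v * hI
  rw [e1, map_smul, LinearMap.trace_id, hdim]
  simp
  ring

end lemA

section smoothsec

variable {W : Type*} [AddCommGroup W] [Module ℝ W]

theorem formula_of (hdim : Module.finrank ℝ W = 6) [FiniteDimensional ℝ W]
    (ε : AlternatingMap ℝ W ℝ (Fin 6)) (hε : ε ≠ 0)
    (Ω A : AlternatingMap ℝ W ℝ (Fin 3)) (K : W →ₗ[ℝ] W)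
    (hK : ∀ (θ : W →ₗ[ℝ] ℝ) (v : W),
      wedge (oneForm θ) (wedge (Ω.curryLeft v) Ω) = θ (K v) • ε)
    (l : ℝ) (hl : l = (6 : ℝ)⁻¹ * LinearMap.trace ℝ W (K ∘ₗ K))
    (a b c : W →ₗ[ℝ] ℂ) (h : cx Ω + Complex.I • cx A = DD ![a, b, c])
    (s : ℝ) (hs0 : 0 < s) (hs : wedge Ω A = s • ε) :
    l < 0 ∧ ∀ u v w : W, A ![u, v, w] = (Real.sqrt (-l))⁻¹ * Ω ![K u, v, w] := by
  have h1 := K_sq hdim ε hε Ω A K hK a b c h s hs0.ne' hs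
  rw [← hl] at h1
  refine ⟨by rw [h1]; have : 0 < (s / 2) ^ 2 := by positivity
             linarith, fun u v w => ?_⟩
  rw [h1, neg_neg, Real.sqrt_sq (by positivity), contract_eq ε hε Ω A K hK a b c h s hs]
  field_simp

theorem alt_ext3 {N : Type*} [AddCommGroup N] [Module ℝ N] (A A' : AlternatingMap ℝ W N (Fin 3))
    (h : ∀ u v w : W, A ![u, v, w] = A' ![u, v, w]) : A = A' := by
  ext v
  have := h (v 0) (v 1) (v 2)
  have e : ![v 0, v 1, v 2] = v := by
    funext i; fin_cases i <;> rfl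
  rwa [e] at this

theorem exists_wedge_gen {m n : ℕ} {E F : Type*} [AddCommGroup E] [Module ℝ E] [AddCommGroup F]
    [Module ℝ F] (f : E →ₗ[ℝ] AlternatingMap ℝ W ℝ (Fin m))
    (g : F →ₗ[ℝ] AlternatingMap ℝ W ℝ (Fin n)) (B : Fin (m + n) → W) :
    ∃ C : E →ₗ[ℝ] F →ₗ[ℝ] ℝ, ∀ x y, C x y = wedge (f x) (g y) B := by
  refine ⟨LinearMap.mk₂ ℝ (fun x y => wedge (f x) (g y) B) ?_ ?_ ?_ ?_, fun _ _ => rfl⟩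
  · intro x x' y
    rw [map_add, wedge_add_left]
    rfl
  · intro r x y
    rw [map_smul, wedge_smul_left]
    rfl
  · intro x y y'
    rw [map_add, wedge_add_right]
    rfl
  · intro r x y
    rw [map_smul, wedge_smul_right]
    rfl

theorem exists_wedge_gen3 {l m n : ℕ} {E F : Type*} [AddCommGroup E] [Module ℝ E]
    [AddCommGroup F] [Module ℝ F] (h : AlternatingMap ℝ W ℝ (Fin l))
    (f : E →ₗ[ℝ] AlternatingMap ℝ W ℝ (Fin m))
    (g : F →ₗ[ℝ] AlternatingMap ℝ W ℝ (Fin n)) (B : Fin (l + (m + n)) → W) :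
    ∃ C : E →ₗ[ℝ] F →ₗ[ℝ] ℝ, ∀ x y, C x y = wedge h (wedge (f x) (g y)) B := by
  refine ⟨LinearMap.mk₂ ℝ (fun x y => wedge h (wedge (f x) (g y)) B) ?_ ?_ ?_ ?_, fun _ _ => rfl⟩
  · intro x x' y
    rw [map_add, wedge_add_left, wedge_add_right]
    rfl
  · intro r x y
    rw [map_smul, wedge_smul_left, wedge_smul_right]
    rfl
  · intro x y y'
    rw [map_add, wedge_add_right, wedge_add_right]
    rfl
  · intro r x y
    rw [map_smul, wedge_smul_right, wedge_smul_right]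
    rfl

set_option maxRecDepth 10000 in
theorem exists_wedge_quad (e : AlternatingMap ℝ W ℝ (Fin 3) ≃ₗ[ℝ] (Fin 20 → ℝ))
    (θ : W →ₗ[ℝ] ℝ) (v : W) (B : Fin 6 → W) :
    ∃ C : (Fin 20 → ℝ) →ₗ[ℝ] (Fin 20 → ℝ) →ₗ[ℝ] ℝ, ∀ x y, C x y =
      (wedge (oneForm θ) (wedge ((e.symm x).curryLeft v) (e.symm y)) :
        AlternatingMap ℝ W ℝ (Fin 6)) B := by
  let cl : (Fin 20 → ℝ) →ₗ[ℝ] AlternatingMap ℝ W ℝ (Fin 2) :=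
    { toFun := fun x => (e.symm x).curryLeft v
      map_add' := fun x y => by rw [map_add]; rfl
      map_smul' := fun r x => by rw [map_smul]; rfl }
  exact exists_wedge_gen3 (oneForm θ) cl e.symm.toLinearMap B

theorem bilin_contDiff (C : (Fin 20 → ℝ) →ₗ[ℝ] (Fin 20 → ℝ) →ₗ[ℝ] ℝ) :
    ContDiff ℝ (⊤ : ℕ∞) (fun p : (Fin 20 → ℝ) × (Fin 20 → ℝ) => C p.1 p.2) :=
  C.toContinuousBilinearMap.isBoundedBilinearMap.contDiff

theorem contDiff_wedge_quad (e : AlternatingMap ℝ W ℝ (Fin 3) ≃ₗ[ℝ] (Fin 20 → ℝ))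
    (θ : W →ₗ[ℝ] ℝ) (v : W) (B : Fin 6 → W) :
    ContDiff ℝ (⊤ : ℕ∞) (fun x : Fin 20 → ℝ =>
      (wedge (oneForm θ) (wedge ((e.symm x).curryLeft v) (e.symm x)) :
        AlternatingMap ℝ W ℝ (Fin 6)) B) := by
  obtain ⟨C, hC⟩ := exists_wedge_quad e θ v B
  have h := (bilin_contDiff C).comp ((contDiff_id (n := (⊤ : ℕ∞))).prodMk contDiff_id)
  have h2 : (fun x : Fin 20 → ℝ =>
      (wedge (oneForm θ) (wedge ((e.symm x).curryLeft v) (e.symm x)) :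
        AlternatingMap ℝ W ℝ (Fin 6)) B) = fun x => C x x := funext fun x => (hC x x).symm
  rw [h2]
  exact h

set_option maxRecDepth 10000 in
theorem exists_wedge (e : AlternatingMap ℝ W ℝ (Fin 3) ≃ₗ[ℝ] (Fin 20 → ℝ))
    (B : Fin 6 → W) :
    ∃ C : (Fin 20 → ℝ) →ₗ[ℝ] (Fin 20 → ℝ) →ₗ[ℝ] ℝ, ∀ x y, C x y =
      (wedge (e.symm x) (e.symm y) : AlternatingMap ℝ W ℝ (Fin 6)) B :=
  exists_wedge_gen e.symm.toLinearMap e.symm.toLinearMap B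

theorem continuous_wedge (e : AlternatingMap ℝ W ℝ (Fin 3) ≃ₗ[ℝ] (Fin 20 → ℝ))
    (B : Fin 6 → W) :
    Continuous (fun p : (Fin 20 → ℝ) × (Fin 20 → ℝ) =>
      (wedge (e.symm p.1) (e.symm p.2) : AlternatingMap ℝ W ℝ (Fin 6)) B) := by
  obtain ⟨C, hC⟩ := exists_wedge e B
  have h2 : (fun p : (Fin 20 → ℝ) × (Fin 20 → ℝ) =>
      (wedge (e.symm p.1) (e.symm p.2) : AlternatingMap ℝ W ℝ (Fin 6)) B) =
        fun p => C p.1 p.2 := funext fun p => (hC p.1 p.2).symm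
  rw [h2]
  exact (bilin_contDiff C).continuous

theorem contDiff_coord (ε : AlternatingMap ℝ W ℝ (Fin 6)) (hε : ε ≠ 0)
    (B : Module.Basis (Fin 6) ℝ W)
    (K : AlternatingMap ℝ W ℝ (Fin 3) → W →ₗ[ℝ] W)
    (hK : ∀ (Ω : AlternatingMap ℝ W ℝ (Fin 3)) (θ : W →ₗ[ℝ] ℝ) (v : W),
      wedge (oneForm θ) (wedge (Ω.curryLeft v) Ω) = θ (K Ω v) • ε)
    (e : AlternatingMap ℝ W ℝ (Fin 3) ≃ₗ[ℝ] (Fin 20 → ℝ)) (θ : W →ₗ[ℝ] ℝ) (v : W) :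
    ContDiff ℝ (⊤ : ℕ∞) (fun x : Fin 20 → ℝ => θ (K (e.symm x) v)) := by
  have hne := (AlternatingMap.map_basis_ne_zero_iff B ε).mpr hε
  have := (contDiff_wedge_quad e θ v B).mul (contDiff_const (c := (ε B)⁻¹))
  suffices h3 : (fun x : Fin 20 → ℝ => θ (K (e.symm x) v)) = _ by
    rw [h3]; exact this
  funext x
  have h2 := congrArg (fun f : AlternatingMap ℝ W ℝ (Fin 6) => f B) (hK (e.symm x) θ v)
  simp only [AlternatingMap.smul_apply, smul_eq_mul] at h2
  refine Eq.symm ?_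
  calc _ = θ (K (e.symm x) v) * ε B * (ε B)⁻¹ := congrArg (· * (ε B)⁻¹) h2
    _ = _ := by field_simp

theorem contDiff_lam (ε : AlternatingMap ℝ W ℝ (Fin 6)) (hε : ε ≠ 0)
    (B : Module.Basis (Fin 6) ℝ W)
    (K : AlternatingMap ℝ W ℝ (Fin 3) → W →ₗ[ℝ] W)
    (hK : ∀ (Ω : AlternatingMap ℝ W ℝ (Fin 3)) (θ : W →ₗ[ℝ] ℝ) (v : W),
      wedge (oneForm θ) (wedge (Ω.curryLeft v) Ω) = θ (K Ω v) • ε)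
    (lam : AlternatingMap ℝ W ℝ (Fin 3) → ℝ)
    (hlam : ∀ Ω, lam Ω = (6 : ℝ)⁻¹ * LinearMap.trace ℝ W (K Ω ∘ₗ K Ω))
    (e : AlternatingMap ℝ W ℝ (Fin 3) ≃ₗ[ℝ] (Fin 20 → ℝ)) :
    ContDiff ℝ (⊤ : ℕ∞) (fun x : Fin 20 → ℝ => lam (e.symm x)) := by
  have : ContDiff ℝ (⊤ : ℕ∞) (fun x : Fin 20 → ℝ => (6 : ℝ)⁻¹ * ∑ i, ∑ j,
      B.coord i (K (e.symm x) (B j)) * B.coord j (K (e.symm x) (B i))) := by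
    refine contDiff_const.mul (ContDiff.sum fun i _ => ContDiff.sum fun j _ => ?_)
    exact (contDiff_coord ε hε B K hK e _ _).mul (contDiff_coord ε hε B K hK e _ _)
  convert this using 1
  funext x
  rw [hlam, LinearMap.trace_eq_matrix_trace ℝ B, LinearMap.toMatrix_comp B B B]
  simp [Matrix.trace, Matrix.mul_apply, LinearMap.toMatrix_apply]

theorem contDiffOn_hat (ε : AlternatingMap ℝ W ℝ (Fin 6)) (hε : ε ≠ 0)
    (B : Module.Basis (Fin 6) ℝ W)
    (K : AlternatingMap ℝ W ℝ (Fin 3) → W →ₗ[ℝ] W)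
    (hK : ∀ (Ω : AlternatingMap ℝ W ℝ (Fin 3)) (θ : W →ₗ[ℝ] ℝ) (v : W),
      wedge (oneForm θ) (wedge (Ω.curryLeft v) Ω) = θ (K Ω v) • ε)
    (lam : AlternatingMap ℝ W ℝ (Fin 3) → ℝ)
    (hlam : ∀ Ω, lam Ω = (6 : ℝ)⁻¹ * LinearMap.trace ℝ W (K Ω ∘ₗ K Ω))
    (hat : AlternatingMap ℝ W ℝ (Fin 3) → AlternatingMap ℝ W ℝ (Fin 3))
    (hform : ∀ Ω, lam Ω < 0 → ∀ u v w : W,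
      hat Ω ![u, v, w] = (Real.sqrt (-lam Ω))⁻¹ * Ω ![K Ω u, v, w])
    (e : AlternatingMap ℝ W ℝ (Fin 3) ≃ₗ[ℝ] (Fin 20 → ℝ)) :
    ContDiffOn ℝ (⊤ : ℕ∞) (fun x => e (hat (e.symm x))) {x | lam (e.symm x) < 0} := by
  let ev : AlternatingMap ℝ W ℝ (Fin 3) →ₗ[ℝ] (Fin 6 × Fin 6 × Fin 6 → ℝ) :=
    { toFun := fun A p => A ![B p.1, B p.2.1, B p.2.2]
      map_add' := fun _ _ => rfl
      map_smul' := fun _ _ => rfl }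
  have hinj : LinearMap.ker ev = ⊥ := by
    rw [LinearMap.ker_eq_bot]
    intro A A' h
    refine Module.Basis.ext_alternating B fun idx _ => ?_
    have h2 := congrFun h (idx 0, idx 1, idx 2)
    have e : ![B (idx 0), B (idx 1), B (idx 2)] = fun i => B (idx i) := by
      funext i; fin_cases i <;> rfl
    rw [← e]
    exact h2
  obtain ⟨L, hL⟩ := LinearMap.exists_leftInverse_of_injective ev hinj
  have hcomp : ContDiffOn ℝ (⊤ : ℕ∞) (fun x => ev (hat (e.symm x))) {x | lam (e.symm x) < 0} := by
    rw [contDiffOn_pi]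
    intro p
    have hsm : ContDiffOn ℝ (⊤ : ℕ∞) (fun x => (Real.sqrt (-lam (e.symm x)))⁻¹ *
        ∑ l, B.coord l (K (e.symm x) (B p.1)) * (e.symm x) ![B l, B p.2.1, B p.2.2])
        {x | lam (e.symm x) < 0} := by
      have hl := contDiff_lam ε hε B K hK lam hlam e
      refine ContDiffOn.mul ?_ (ContDiff.contDiffOn (ContDiff.sum fun l _ => ?_))
      · refine ContDiffOn.inv (ContDiffOn.sqrt hl.neg.contDiffOn ?_) ?_
        · intro x hx
          have : lam (e.symm x) < 0 := hx
          linarith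
        · intro x hx
          have : lam (e.symm x) < 0 := hx
          exact (Real.sqrt_pos.mpr (by linarith)).ne'
      · refine (contDiff_coord ε hε B K hK e _ _).mul ?_
        exact (LinearMap.toContinuousLinearMap
          (LinearMap.proj (l, p.2.1, p.2.2) ∘ₗ ev ∘ₗ e.symm.toLinearMap)).contDiff
    refine hsm.congr fun x hx => ?_
    change hat (e.symm x) ![B p.1, B p.2.1, B p.2.2] = _
    rw [hform _ hx]
    congr 1
    conv_lhs => rw [← B.sum_repr (K (e.symm x) (B p.1))]
    have := (AlternatingMap.toMultilinearMap (e.symm x)).map_update_sum (t := Finset.univ)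
      (i := 0) (g := fun l => B.repr (K (e.symm x) (B p.1)) l • B l)
      (m := ![0, B p.2.1, B p.2.2])
    simp only [AlternatingMap.coe_multilinearMap] at this
    have hu (z : W) : Function.update ![0, B p.2.1, B p.2.2] 0 z = ![z, B p.2.1, B p.2.2] := by
      funext i; fin_cases i <;> rfl
    simp only [hu] at this
    refine this.trans (Finset.sum_congr rfl fun l _ => ?_)
    have h3 := (e.symm x).map_update_smul ![0, B p.2.1, B p.2.2] 0
      (B.repr (K (e.symm x) (B p.1)) l) (B l)
    simp only [hu] at h3
    exact h3
  have := (LinearMap.toContinuousLinearMap (e.toLinearMap ∘ₗ L)).contDiff (n := (⊤ : ℕ∞)) |>.comp_contDiffOn hcomp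
  refine this.congr fun x _ => ?_
  have h2 := LinearMap.congr_fun hL (hat (e.symm x))
  simp only [LinearMap.comp_apply, LinearMap.id_apply] at h2
  simp [h2]

end smoothsec

section surjsec

variable {W : Type*} [AddCommGroup W] [Module ℝ W]

/-- Real part of a complex form. -/
def reF {n : ℕ} : AlternatingMap ℝ W ℂ (Fin n) →ₗ[ℝ] AlternatingMap ℝ W ℝ (Fin n) where
  toFun α := Complex.reLm.compAlternatingMap α
  map_add' _ _ := by ext; simp
  map_smul' _ _ := by ext; simp

/-- Imaginary part of a complex form. -/
def imF {n : ℕ} : AlternatingMap ℝ W ℂ (Fin n) →ₗ[ℝ] AlternatingMap ℝ W ℝ (Fin n) where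
  toFun α := Complex.imLm.compAlternatingMap α
  map_add' _ _ := by ext; simp
  map_smul' _ _ := by ext; simp

theorem reF_apply {n : ℕ} (α : AlternatingMap ℝ W ℂ (Fin n)) (v : Fin n → W) :
    reF α v = (α v).re := rfl

theorem imF_apply {n : ℕ} (α : AlternatingMap ℝ W ℂ (Fin n)) (v : Fin n → W) :
    imF α v = (α v).im := rfl

theorem re_im_split {n : ℕ} (α : AlternatingMap ℝ W ℂ (Fin n)) :
    cx (reF α) + Complex.I • cx (imF α) = α := by
  ext v
  simp [cx_apply, reF_apply, imF_apply]
  rw [mul_comm]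
  exact Complex.re_add_im _

/-- The differential of the wedge product of three covectors. -/
def VV (a b c a' b' c' : W →ₗ[ℝ] ℂ) : AlternatingMap ℝ W ℂ (Fin 3) :=
  DD ![a', b, c] + DD ![a, b', c] + DD ![a, b, c']

theorem VV_add (a b c x y z x' y' z' : W →ₗ[ℝ] ℂ) :
    VV a b c (x + x') (y + y') (z + z') = VV a b c x y z + VV a b c x' y' z' := by
  ext v
  simp [VV, DD_apply, Matrix.det_fin_three]
  ring

theorem VV_smul (a b c x y z : W →ₗ[ℝ] ℂ) (r : ℂ) :
    VV a b c (r • x) (r • y) (r • z) = r • VV a b c x y z := by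
  ext v
  simp [VV, DD_apply, Matrix.det_fin_three]
  ring

theorem VV_two (a b c m : W →ₗ[ℝ] ℂ) (p q r p' q' r' : ℂ) :
    VV a b c ((q * r' - r * q') • m) ((r * p' - p * r') • m) ((p * q' - q * p') • m) =
      DD ![p • a + q • b + r • c, p' • a + q' • b + r' • c, m] := by
  ext v
  simp [VV, DD_apply, Matrix.det_fin_three]
  ring

/-- The tangent space, as a real submodule. -/
def TT (a b c : W →ₗ[ℝ] ℂ) : Submodule ℝ (AlternatingMap ℝ W ℝ (Fin 3)) where
  carrier := {A | ∃ x y z, A = reF (VV a b c x y z)}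
  zero_mem' := ⟨(0 : ℂ) • a, (0 : ℂ) • a, (0 : ℂ) • a, by rw [VV_smul]; simp⟩
  add_mem' := by
    rintro _ _ ⟨x, y, z, rfl⟩ ⟨x', y', z', rfl⟩
    exact ⟨x + x', y + y', z + z', by rw [VV_add, map_add]⟩
  smul_mem' := by
    rintro r _ ⟨x, y, z, rfl⟩
    refine ⟨(r : ℂ) • x, (r : ℂ) • y, (r : ℂ) • z, ?_⟩
    rw [VV_smul]
    ext v
    simp [reF_apply]

theorem cov_exists (hdim : Module.finrank ℝ W = 6) [FiniteDimensional ℝ W]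
    (a b c : W →ₗ[ℝ] ℂ) (hinj : ∀ v, a v = 0 → b v = 0 → c v = 0 → v = 0) (x : W →ₗ[ℝ] ℝ) :
    ∃ p q r : ℂ, x = Complex.reLm ∘ₗ (p • a + q • b + r • c) := by
  let ℓ : W →ₗ[ℝ] ℂ × ℂ × ℂ := a.prod (b.prod c)
  have hℓ : Function.Injective ℓ := by
    rw [← LinearMap.ker_eq_bot, LinearMap.ker_eq_bot']
    intro v hv
    have h1 : (a v, b v, c v) = (0, 0, 0) := hv
    simp only [Prod.mk.injEq] at h1
    exact hinj v h1.1 h1.2.1 h1.2.2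
  have hfr : Module.finrank ℝ W = Module.finrank ℝ (ℂ × ℂ × ℂ) := by
    rw [hdim, Module.finrank_prod, Module.finrank_prod, Complex.finrank_real_complex]
  let E := LinearMap.linearEquivOfInjective ℓ hℓ hfr
  have hE : ∀ v, E v = (a v, b v, c v) := fun v => rfl
  let f : ℂ × ℂ × ℂ →ₗ[ℝ] ℝ := x ∘ₗ E.symm.toLinearMap
  refine ⟨f (1, 0, 0) - Complex.I * f (Complex.I, 0, 0),
    f (0, 1, 0) - Complex.I * f (0, Complex.I, 0),
    f (0, 0, 1) - Complex.I * f (0, 0, Complex.I), ?_⟩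
  ext v
  have hx : x v = f (a v, b v, c v) := by
    rw [← hE]; simp [f]
  have hdec : (a v, b v, c v) = (a v).re • ((1, 0, 0) : ℂ × ℂ × ℂ)
      + (a v).im • ((Complex.I, 0, 0) : ℂ × ℂ × ℂ) + (b v).re • ((0, 1, 0) : ℂ × ℂ × ℂ)
      + (b v).im • ((0, Complex.I, 0) : ℂ × ℂ × ℂ) + (c v).re • ((0, 0, 1) : ℂ × ℂ × ℂ)
      + (c v).im • ((0, 0, Complex.I) : ℂ × ℂ × ℂ) := by
    simp [Complex.re_add_im]
  rw [hx, hdec]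
  simp only [map_add, map_smul]
  simp
  ring

theorem DD_re (u v w : W →ₗ[ℝ] ℂ) :
    DD ![Complex.reLm ∘ₗ u, Complex.reLm ∘ₗ v, Complex.reLm ∘ₗ w] =
      (4 : ℝ)⁻¹ • (reF (DD ![u, v, w]) + reF (DD ![u, v, cj w]) + reF (DD ![w, u, cj v])
        + reF (DD ![v, w, cj u])) := by
  ext z
  simp [DD_apply, Matrix.det_fin_three, reF_apply, cj_apply]
  ring

theorem DD_mem (hdim : Module.finrank ℝ W = 6) [FiniteDimensional ℝ W]
    (a b c : W →ₗ[ℝ] ℂ) (hinj : ∀ v, a v = 0 → b v = 0 → c v = 0 → v = 0) (x y z : W →ₗ[ℝ] ℝ) :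
    DD ![x, y, z] ∈ TT a b c := by
  obtain ⟨p, q, r, rfl⟩ := cov_exists hdim a b c hinj x
  obtain ⟨p', q', r', rfl⟩ := cov_exists hdim a b c hinj y
  obtain ⟨p'', q'', r'', rfl⟩ := cov_exists hdim a b c hinj z
  rw [DD_re]
  have key (p q r p' q' r' : ℂ) (m : W →ₗ[ℝ] ℂ) :
      reF (DD ![p • a + q • b + r • c, p' • a + q' • b + r' • c, m]) ∈ TT a b c :=
    ⟨_, _, _, by rw [← VV_two]⟩
  refine Submodule.smul_mem _ _ (add_mem (add_mem (add_mem ?_ ?_) ?_) ?_) <;> apply key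

theorem alt_sum_apply {ι : Type*} (t : Finset ι) (f : ι → AlternatingMap ℝ W ℝ (Fin 3))
    (v : Fin 3 → W) : (∑ i ∈ t, f i) v = ∑ i ∈ t, f i v := by
  let ev : AlternatingMap ℝ W ℝ (Fin 3) →ₗ[ℝ] ℝ :=
    { toFun := fun A => A v
      map_add' := fun _ _ => rfl
      map_smul' := fun _ _ => rfl }
  exact map_sum ev f t

theorem form_expand (B : Module.Basis (Fin 6) ℝ W) (A : AlternatingMap ℝ W ℝ (Fin 3)) :
    (6 : ℝ) • A = ∑ i, ∑ j, ∑ k, A ![B i, B j, B k] • DD ![B.coord i, B.coord j, B.coord k] := by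
  refine Module.Basis.ext_alternating B fun idx _ => ?_
  have e0 : (fun i => B (idx i)) = ![B (idx 0), B (idx 1), B (idx 2)] := by
    funext i; fin_cases i <;> rfl
  rw [e0]
  generalize idx 0 = l
  generalize idx 1 = m
  generalize idx 2 = n
  have p1 : A ![B l, B n, B m] = - A ![B l, B m, B n] := by
    have := A.map_swap ![B l, B m, B n] (i := 1) (j := 2) (by decide)
    rw [← this]; congr 1; funext i; fin_cases i <;> rfl
  have p2 (l m n) : A ![B m, B l, B n] = - A ![B l, B m, B n] := by
    have := A.map_swap ![B l, B m, B n] (i := 0) (j := 1) (by decide)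
    rw [← this]; congr 1; funext i; fin_cases i <;> rfl
  have p3 (l m n) : A ![B n, B m, B l] = - A ![B l, B m, B n] := by
    have := A.map_swap ![B l, B m, B n] (i := 0) (j := 2) (by decide)
    rw [← this]; congr 1; funext i; fin_cases i <;> rfl
  simp only [alt_sum_apply, AlternatingMap.smul_apply, DD_apply,
    Matrix.det_fin_three, smul_eq_mul]
  simp [Finsupp.single_apply, mul_add, mul_sub, Finset.sum_add_distrib, Finset.sum_sub_distrib]
  linarith [p1, p2 l m n, p2 l n m, p3 l n m, p3 l m n]

theorem TT_top (hdim : Module.finrank ℝ W = 6) [FiniteDimensional ℝ W]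
    (a b c : W →ₗ[ℝ] ℂ) (hinj : ∀ v, a v = 0 → b v = 0 → c v = 0 → v = 0)
    (A : AlternatingMap ℝ W ℝ (Fin 3)) : A ∈ TT a b c := by
  have B : Module.Basis (Fin 6) ℝ W := Module.finBasisOfFinrankEq ℝ W hdim
  have : A = (6 : ℝ)⁻¹ • ((6 : ℝ) • A) := by rw [smul_smul]; norm_num
  rw [this, form_expand B]
  exact Submodule.smul_mem _ _ (Submodule.sum_mem _ fun i _ => Submodule.sum_mem _ fun j _ =>
    Submodule.sum_mem _ fun k _ => Submodule.smul_mem _ _ (DD_mem hdim a b c hinj _ _ _))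

end surjsec

section finalsec

variable {W : Type*} [AddCommGroup W] [Module ℝ W]

theorem DD_curve (a b c a' b' c' : W →ₗ[ℝ] ℂ) (t : ℝ) :
    DD ![a + t • a', b + t • b', c + t • c'] =
      DD ![a, b, c] + t • VV a b c a' b' c' +
        t ^ 2 • (DD ![a', b', c] + DD ![a', b, c'] + DD ![a, b', c']) +
        t ^ 3 • DD ![a', b', c'] := by
  ext v
  simp [VV, DD_apply, Matrix.det_fin_three]
  ring

theorem hasDerivAt_cubic {E : Type*} [NormedAddCommGroup E] [NormedSpace ℝ E] (p q r s : E) :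
    HasDerivAt (fun t : ℝ => p + t • q + t ^ 2 • r + t ^ 3 • s) q 0 := by
  have h1 : HasDerivAt (fun t : ℝ => t • q) ((1 : ℝ) • q) 0 := (hasDerivAt_id (0 : ℝ)).smul_const q
  have h2 := (hasDerivAt_pow 2 (0 : ℝ)).smul_const r
  have h3 := (hasDerivAt_pow 3 (0 : ℝ)).smul_const s
  have h := (((hasDerivAt_const (0 : ℝ) p).add h1).add h2).add h3
  refine h.congr_deriv ?_
  simp

theorem hasDerivAt_curve (g : AlternatingMap ℝ W ℂ (Fin 3) →ₗ[ℝ] (Fin 20 → ℝ))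
    (a b c a' b' c' : W →ₗ[ℝ] ℂ) :
    HasDerivAt (fun t : ℝ => g (DD ![a + t • a', b + t • b', c + t • c']))
      (g (VV a b c a' b' c')) 0 := by
  have h := hasDerivAt_cubic (g (DD ![a, b, c])) (g (VV a b c a' b' c'))
    (g (DD ![a', b', c] + DD ![a', b, c'] + DD ![a, b', c'])) (g (DD ![a', b', c']))
  refine h.congr_of_eventuallyEq (Filter.Eventually.of_forall fun t => ?_)
  simp only [DD_curve, map_add, map_smul]

theorem top_form (ε : AlternatingMap ℝ W ℝ (Fin 6)) (hε : ε ≠ 0)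
    (B : Module.Basis (Fin 6) ℝ W) (f : AlternatingMap ℝ W ℝ (Fin 6)) :
    f = (f B / ε B) • ε := by
  have hne := (AlternatingMap.map_basis_ne_zero_iff B ε).mpr hε
  have h1 := AlternatingMap.eq_smul_basis_det B f
  have h2 := AlternatingMap.eq_smul_basis_det B ε
  ext v
  have h3 := congrArg (fun k : AlternatingMap ℝ W ℝ (Fin 6) => k v) h1
  have h4 := congrArg (fun k : AlternatingMap ℝ W ℝ (Fin 6) => k v) h2
  simp only [AlternatingMap.smul_apply, smul_eq_mul] at h3 h4 ⊢
  rw [h3]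
  conv_rhs => rw [h4]
  field_simp

set_option maxRecDepth 10000 in
theorem deriv_hat (ε : AlternatingMap ℝ W ℝ (Fin 6)) (hε : ε ≠ 0)
    (B : Module.Basis (Fin 6) ℝ W)
    (hat : AlternatingMap ℝ W ℝ (Fin 3) → AlternatingMap ℝ W ℝ (Fin 3))
    (huniq : ∀ (Ω A : AlternatingMap ℝ W ℝ (Fin 3)) (a b c : W →ₗ[ℝ] ℂ) (s : ℝ), 0 < s →
      cx Ω + Complex.I • cx A = DD ![a, b, c] → wedge Ω A = s • ε → hat Ω = A)
    (e : AlternatingMap ℝ W ℝ (Fin 3) ≃ₗ[ℝ] (Fin 20 → ℝ))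
    (Ω A : AlternatingMap ℝ W ℝ (Fin 3)) (a b c : W →ₗ[ℝ] ℂ) (s : ℝ) (hs0 : 0 < s)
    (h : cx Ω + Complex.I • cx A = DD ![a, b, c]) (hs : wedge Ω A = s • ε)
    (D : (Fin 20 → ℝ) →L[ℝ] (Fin 20 → ℝ))
    (hD : HasFDerivAt (fun x => e (hat (e.symm x))) D (e Ω)) (a' b' c' : W →ₗ[ℝ] ℂ) :
    D (e (reF (VV a b c a' b' c'))) = e (imF (VV a b c a' b' c')) := by
  have hne := (AlternatingMap.map_basis_ne_zero_iff B ε).mpr hε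
  have hre : reF (DD ![a, b, c]) = Ω := by
    rw [← h]; ext v; simp [reF_apply, cx_apply]
  have him : imF (DD ![a, b, c]) = A := by
    rw [← h]; ext v; simp [imF_apply, cx_apply]
  have hx := hasDerivAt_curve (e.toLinearMap ∘ₗ reF) a b c a' b' c'
  have hy := hasDerivAt_curve (e.toLinearMap ∘ₗ imF) a b c a' b' c'
  simp only [LinearMap.comp_apply, LinearEquiv.coe_coe] at hx hy
  let S : (Fin 20 → ℝ) × (Fin 20 → ℝ) → ℝ := fun p =>
      (wedge (e.symm p.1) (e.symm p.2) : AlternatingMap ℝ W ℝ (Fin 6)) B / ε B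
  have hS : Continuous S := (continuous_wedge e B).div_const _
  let T : ℝ → (Fin 20 → ℝ) × (Fin 20 → ℝ) := fun t =>
    (e (reF (DD ![a + t • a', b + t • b', c + t • c'])),
      e (imF (DD ![a + t • a', b + t • b', c + t • c'])))
  have hT : ContinuousAt T 0 := hx.continuousAt.prodMk hy.continuousAt
  have hT0 : T 0 = (e Ω, e A) := by
    simp only [T, zero_smul, add_zero, hre, him]
  have hS0 : S (T 0) = s := by
    rw [hT0]
    simp only [S, LinearEquiv.symm_apply_apply]
    have := congrArg (fun k : AlternatingMap ℝ W ℝ (Fin 6) => k B) hs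
    simp only [AlternatingMap.smul_apply, smul_eq_mul] at this
    rw [div_eq_iff hne]
    exact this
  have hev : ∀ᶠ t in nhds (0 : ℝ), 0 < S (T t) := by
    have hc : ContinuousAt (fun t => S (T t)) 0 := hS.continuousAt.comp hT
    exact hc.eventually (lt_mem_nhds (hs0.trans_eq hS0.symm))
  have hx0 : e (reF (DD ![a + (0 : ℝ) • a', b + (0 : ℝ) • b', c + (0 : ℝ) • c'])) = e Ω := by
    simp only [zero_smul, add_zero, hre]
  have hcomp := HasFDerivAt.comp_hasDerivAt_of_eq (0 : ℝ) hD hx hx0.symm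
  refine hcomp.unique (hy.congr_of_eventuallyEq ?_)
  filter_upwards [hev] with t ht
  simp only [Function.comp_apply, LinearEquiv.symm_apply_apply]
  congr 1
  refine huniq _ _ _ _ _ (S (T t)) ht (re_im_split _) ?_
  have := top_form ε hε B (wedge (reF (DD ![a + t • a', b + t • b', c + t • c']))
    (imF (DD ![a + t • a', b + t • b', c + t • c'])))
  simp only [S, T, LinearEquiv.symm_apply_apply]
  exact this

end finalsec

/-- The map `Ω ↦ Ω̂` is smooth on `U = {λ < 0}`, and the
derivative `J_Ω` at `Ω ∈ U` of `Ω' ↦ −Ω̂'` satisfies `J_Ω ∘ J_Ω = −id`, so `J`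
is an almost complex structure on the 20-dimensional open set `U`.
(Smoothness and derivatives are expressed after transporting `Λ³W*` to `ℝ²⁰`
by an arbitrary linear coordinate isomorphism `e`.) -/
theorem stmt11 (W : Type*) [AddCommGroup W] [Module ℝ W] [FiniteDimensional ℝ W]
    (hdim : Module.finrank ℝ W = 6)
    (ε : AlternatingMap ℝ W ℝ (Fin 6)) (hε : ε ≠ 0)
    (K : AlternatingMap ℝ W ℝ (Fin 3) → W →ₗ[ℝ] W)
    (hK : ∀ (Ω : AlternatingMap ℝ W ℝ (Fin 3)) (θ : W →ₗ[ℝ] ℝ) (v : W),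
      wedge (oneForm θ) (wedge (Ω.curryLeft v) Ω) = θ (K Ω v) • ε)
    (lam : AlternatingMap ℝ W ℝ (Fin 3) → ℝ)
    (hlam : ∀ Ω, lam Ω = (6 : ℝ)⁻¹ * LinearMap.trace ℝ W (K Ω ∘ₗ K Ω))
    (hat : AlternatingMap ℝ W ℝ (Fin 3) → AlternatingMap ℝ W ℝ (Fin 3))
    (hhat : ∀ Ω, lam Ω < 0 →
      IsDecomposable (cx Ω + Complex.I • cx (hat Ω)) ∧
        ∃ c : ℝ, 0 < c ∧ wedge Ω (hat Ω) = c • ε)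
    (e : AlternatingMap ℝ W ℝ (Fin 3) ≃ₗ[ℝ] (Fin 20 → ℝ)) :
    ContDiffOn ℝ (⊤ : ℕ∞) (fun x => e (hat (e.symm x)))
        (e '' {Ω : AlternatingMap ℝ W ℝ (Fin 3) | lam Ω < 0}) ∧
      ∀ Ω : AlternatingMap ℝ W ℝ (Fin 3), lam Ω < 0 →
        ∃ J : (Fin 20 → ℝ) →L[ℝ] (Fin 20 → ℝ),
          HasFDerivAt (fun x => e (-hat (e.symm x))) J (e Ω) ∧
            J.comp J = -(ContinuousLinearMap.id ℝ (Fin 20 → ℝ)) := by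
  have B : Module.Basis (Fin 6) ℝ W := Module.finBasisOfFinrankEq ℝ W hdim
  have hdata : ∀ Ω, lam Ω < 0 → ∃ (a b c : W →ₗ[ℝ] ℂ) (s : ℝ), 0 < s ∧
      cx Ω + Complex.I • cx (hat Ω) = DD ![a, b, c] ∧ wedge Ω (hat Ω) = s • ε := by
    intro Ω hΩ
    obtain ⟨⟨a, b, c, h⟩, s, hs0, hs⟩ := hhat Ω hΩ
    exact ⟨a, b, c, s, hs0, h.trans (wedge111 a b c), hs⟩
  have hform : ∀ Ω, lam Ω < 0 → ∀ u v w : W,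
      hat Ω ![u, v, w] = (Real.sqrt (-lam Ω))⁻¹ * Ω ![K Ω u, v, w] := by
    intro Ω hΩ
    obtain ⟨a, b, c, s, hs0, h, hs⟩ := hdata Ω hΩ
    exact (formula_of hdim ε hε Ω (hat Ω) (K Ω) (hK Ω) _ (hlam Ω) a b c h s hs0 hs).2
  have huniq : ∀ (Ω A : AlternatingMap ℝ W ℝ (Fin 3)) (a b c : W →ₗ[ℝ] ℂ) (s : ℝ), 0 < s →
      cx Ω + Complex.I • cx A = DD ![a, b, c] → wedge Ω A = s • ε → hat Ω = A := by
    intro Ω A a b c s hs0 h hs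
    obtain ⟨h1, h2⟩ := formula_of hdim ε hε Ω A (K Ω) (hK Ω) _ (hlam Ω) a b c h s hs0 hs
    refine alt_ext3 _ _ fun u v w => ?_
    rw [hform Ω h1, h2]
  have hset : e '' {Ω : AlternatingMap ℝ W ℝ (Fin 3) | lam Ω < 0} =
      {x | lam (e.symm x) < 0} := by
    ext x
    constructor
    · rintro ⟨Ω, hΩ, rfl⟩
      simpa using hΩ
    · intro hx
      exact ⟨e.symm x, hx, by simp⟩
  have hsm := contDiffOn_hat ε hε B K hK lam hlam hat hform e
  refine ⟨by rw [hset]; exact hsm, ?_⟩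
  intro Ω hΩ
  have hopen : IsOpen {x | lam (e.symm x) < 0} :=
    isOpen_lt (contDiff_lam ε hε B K hK lam hlam e).continuous continuous_const
  have hmem : e Ω ∈ {x | lam (e.symm x) < 0} := by simpa using hΩ
  have hdiff : DifferentiableAt ℝ (fun x => e (hat (e.symm x))) (e Ω) :=
    (hsm.contDiffAt (hopen.mem_nhds hmem)).differentiableAt (by simp)
  obtain ⟨D, hD⟩ := hdiff
  refine ⟨-D, ?_, ?_⟩
  · have h1 := hD.neg
    refine h1.congr_of_eventuallyEq (Filter.Eventually.of_forall fun x => ?_)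
    simp
  · obtain ⟨a, b, c, s, hs0, h, hs⟩ := hdata Ω hΩ
    have key := deriv_hat ε hε B hat huniq e Ω (hat Ω) a b c s hs0 h hs D hD
    ext1 x
    obtain ⟨p, q, r, hx⟩ := TT_top hdim a b c
      (inj_of hdim ε hε Ω (hat Ω) a b c h s hs0.ne' hs) (e.symm x)
    have hx2 : x = e (reF (VV a b c p q r)) := by rw [← hx]; simp
    have k1 := key p q r
    have k2 := key (Complex.I • p) (Complex.I • q) (Complex.I • r)
    rw [VV_smul] at k2
    have e1 : reF (Complex.I • VV a b c p q r) = - imF (VV a b c p q r) := by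
      ext v; simp [reF_apply, imF_apply]
    have e2 : imF (Complex.I • VV a b c p q r) = reF (VV a b c p q r) := by
      ext v; simp [reF_apply, imF_apply]
    rw [e1, e2, map_neg, map_neg] at k2
    have k3 : D (D x) = -x := by
      rw [hx2, k1, ← k2, neg_neg]
    simp [k3]
end
end
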